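/- arXiv:2204.00099 — 5 statements merged into one kernel-verified Lean document; each statement's English description precedes it below -/
import Mathlib

section
/- Let X₁, X₂, Y₁, Y₂ be natural numbers. If |sin X₁ − sin X₂| = |sin Y₁ − sin Y₂| ≠ 0, then {X₁, X₂} = {Y₁, Y₂} as sets. -/
open Polynomial in
/-- The values of an integer polynomial at Gaussian integers are Gaussian integers. -/
lemma exists_toComplex_eq_aeval (g : ℤ[X]) (z : GaussianInt) :
    ∃ w : GaussianInt, aeval (GaussianInt.toComplex z) g = GaussianInt.toComplex w :=
  ⟨aeval z g, aeval_algHom_apply GaussianInt.toComplex.toIntAlgHom z g⟩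

/-- A Gaussian integer whose real part is nonzero has norm at least one. -/
lemma one_le_norm_toComplex {w : GaussianInt} (hw : w.re ≠ 0) :
    1 ≤ ‖GaussianInt.toComplex w‖ := by
  refine le_trans ?_ (Complex.abs_re_le_norm _)
  rw [← GaussianInt.intCast_re, ← Int.cast_abs]
  exact_mod_cast Int.one_le_abs hw

open Polynomial Finset in
/-- The number `e ^ i` is transcendental (a case of the Hermite–Lindemann theorem). -/
theorem transcendental_exp_I : Transcendental ℤ (Complex.exp Complex.I) := by
  intro halg
  obtain ⟨q, hq0, hq⟩ := halg.exists_nonzero_coeff_and_aeval_eq_zero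
    (mem_nonZeroDivisors_of_ne_zero (Complex.exp_ne_zero _))
  set d := q.natDegree with hd
  set f : ℤ[X] := ∏ k ∈ range d, (X ^ 2 + C (((k : ℤ) + 1) ^ 2)) with hf
  have hf0 : f.eval 0 ≠ 0 := by
    rw [hf, eval_prod, prod_ne_zero_iff]
    intro k _
    simp only [eval_add, eval_pow, eval_X, eval_C]
    positivity
  have hroot : ∀ k ∈ range d, ((k : ℂ) + 1) * Complex.I ∈ f.aroots ℂ := by
    intro k hk
    rw [mem_aroots]
    refine ⟨fun h => hf0 (by simp [h]), ?_⟩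
    rw [hf, map_prod]
    refine prod_eq_zero hk ?_
    simp [mul_pow]
  obtain ⟨c, hc⟩ := LindemannWeierstrass.exp_polynomial_approx f hf0
  set K : ℝ := ∑ k ∈ range d, |(q.coeff (k + 1) : ℝ)| with hK
  have hlim := FloorSemiring.tendsto_mul_pow_div_factorial_sub_atTop K c 1
  obtain ⟨M, hM⟩ := Filter.eventually_atTop.1 (hlim.eventually (gt_mem_nhds one_pos))
  obtain ⟨p, hpM, hp⟩ :=
    Nat.exists_infinite_primes (M + ((eval 0 f).natAbs + 1) + ((q.coeff 0).natAbs + 1))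
  obtain ⟨n, hn, g, -, hg⟩ := hc p (by omega) hp
  have hgauss (k : ℕ) : ∃ w : GaussianInt,
      aeval (((k : ℂ) + 1) * Complex.I) g = GaussianInt.toComplex w := by
    obtain ⟨w, hw⟩ := exists_toComplex_eq_aeval g ⟨0, (k : ℤ) + 1⟩
    refine ⟨w, hw ▸ ?_⟩
    simp [GaussianInt.toComplex_def]
  choose w hw using hgauss
  set W : GaussianInt := (n * q.coeff 0 : ℤ) + (p : ℤ) * ∑ k ∈ range d, (q.coeff (k + 1) : ℤ) * w k
    with hW
  have hWre : W.re ≠ 0 := by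
    intro h
    have h1 : W.re = n * q.coeff 0 +
        p * (∑ k ∈ range d, (q.coeff (k + 1) : GaussianInt) * w k).re := by
      simp [hW]
    rw [h] at h1
    have h2 : (p : ℤ) ∣ n * q.coeff 0 :=
      (dvd_add_left (dvd_mul_right _ _)).1 (h1 ▸ dvd_zero _)
    rcases (Nat.prime_iff_prime_int.1 hp).dvd_or_dvd h2 with h3 | h3
    · exact hn h3
    · have := Nat.le_of_dvd (Int.natAbs_pos.2 hq0) (Int.natCast_dvd.1 h3)
      omega
  have hexp : (q.coeff 0 : ℂ) +
      ∑ k ∈ range d, (q.coeff (k + 1) : ℂ) * Complex.exp (((k : ℂ) + 1) * Complex.I) = 0 := by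
    rw [aeval_eq_sum_range, sum_range_succ'] at hq
    rw [← hq, add_comm]
    simp [hd, ← Complex.exp_nat_mul]
  have hWval : GaussianInt.toComplex W = -∑ k ∈ range d, (q.coeff (k + 1) : ℂ) *
      (n • Complex.exp (((k : ℂ) + 1) * Complex.I) - p • aeval (((k : ℂ) + 1) * Complex.I) g) := by
    simp only [hW, hw, map_add, map_mul, map_sum, map_intCast, zsmul_eq_mul, nsmul_eq_mul,
      mul_sub, sum_sub_distrib, mul_left_comm _ (n : ℂ), mul_left_comm _ (p : ℂ), ← mul_sum]
    push_cast
    linear_combination (n : ℂ) * hexp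
  have hle : ‖GaussianInt.toComplex W‖ ≤ K * c ^ p / (p - 1).factorial := by
    rw [hWval, norm_neg, mul_div_assoc, hK, sum_mul]
    refine norm_sum_le_of_le _ fun k hk => ?_
    rw [norm_mul, Complex.norm_intCast]
    exact mul_le_mul_of_nonneg_left (hg (hroot k hk)) (abs_nonneg _)
  exact absurd (one_le_norm_toComplex hWre) (not_le.2 (hle.trans_lt (hM p (by omega))))

open Polynomial in
/-- Multiplying `2 i sin x` by `e ^ (i N)` gives a polynomial expression in `e ^ i`. -/
lemma aeval_exp_I_X_pow_sub {N x : ℕ} (hx : x ≤ N) :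
    aeval (Complex.exp Complex.I) (X ^ (N + x) - X ^ (N - x) : ℤ[X]) =
      2 * Complex.I * Complex.exp (N * Complex.I) * (Real.sin x : ℝ) := by
  have h (y : ℂ) : Complex.exp (N * Complex.I + y * Complex.I) =
      Complex.exp (N * Complex.I) * (Complex.cos y + Complex.sin y * Complex.I) := by
    rw [Complex.exp_add, Complex.exp_mul_I y]
  have h1 := h x
  have h2 := h (-x)
  rw [← add_mul] at h1 h2
  simp only [map_sub, map_pow, aeval_X, ← Complex.exp_nat_mul, Complex.ofReal_sin,
    Complex.ofReal_natCast, Nat.cast_add, Nat.cast_sub hx]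
  rw [sub_eq_add_neg (N : ℂ), h1, h2, Complex.cos_neg, Complex.sin_neg]
  ring

open Polynomial in
/-- Equal differences of sines of natural numbers arise only from equal pairs. -/
theorem eq_and_eq_of_sin_sub_sin_eq {a b c d : ℕ} (hab : a ≠ b)
    (h : Real.sin a - Real.sin b = Real.sin c - Real.sin d) : a = c ∧ b = d := by
  set N := a + b + c + d with hN
  set Q : ℤ[X] := (X ^ (N + a) - X ^ (N - a)) - (X ^ (N + b) - X ^ (N - b)) -
    ((X ^ (N + c) - X ^ (N - c)) - (X ^ (N + d) - X ^ (N - d))) with hQ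
  have hQ0 : Q = 0 := by
    refine transcendental_iff.1 transcendental_exp_I Q ?_
    have h' : ((Real.sin a : ℝ) : ℂ) - (Real.sin b : ℝ) = (Real.sin c : ℝ) - (Real.sin d : ℝ) := by
      exact_mod_cast h
    rw [hQ, map_sub, map_sub (aeval _) (_ - _) (X ^ (N + b) - _),
      map_sub (aeval _) (_ - _) (X ^ (N + d) - _), aeval_exp_I_X_pow_sub (by omega),
      aeval_exp_I_X_pow_sub (by omega), aeval_exp_I_X_pow_sub (by omega),
      aeval_exp_I_X_pow_sub (by omega)]
    linear_combination 2 * Complex.I * Complex.exp (N * Complex.I) * h'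
  have key (m : ℕ) (hm : m ≠ 0) : (if m = a then 1 else 0) - (if m = b then 1 else 0) =
      (if m = c then 1 else 0) - (if m = d then (1 : ℤ) else 0) := by
    have h1 (x : ℕ) : (X ^ (N + x) - X ^ (N - x) : ℤ[X]).coeff (N + m) =
        if m = x then 1 else 0 := by
      rw [coeff_sub, coeff_X_pow, coeff_X_pow, if_neg (show ¬N + m = N - x by omega), sub_zero]
      simp
    have h2 := congrArg (coeff · (N + m)) hQ0
    rw [hQ] at h2
    simp only [coeff_sub _ (X ^ (N + c) - _ - _), coeff_sub (_ - _) (_ - _), h1, coeff_zero] at h2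
    linarith
  have ha := key a
  have hb := key b
  have hc := key c
  have hd := key d
  grind

/-- **Lemma 3.6.** For natural numbers `X₁, X₂, Y₁, Y₂`, if
`|sin X₁ − sin X₂| = |sin Y₁ − sin Y₂| ≠ 0`, then `{X₁, X₂} = {Y₁, Y₂}` as
sets. -/
theorem sine_diff_eq_of_abs_eq (X₁ X₂ Y₁ Y₂ : ℕ)
    (h : |Real.sin X₁ - Real.sin X₂| = |Real.sin Y₁ - Real.sin Y₂|)
    (h0 : |Real.sin X₁ - Real.sin X₂| ≠ 0) :
    ({X₁, X₂} : Set ℕ) = {Y₁, Y₂} := by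
  have hne : X₁ ≠ X₂ := by
    rintro rfl
    simp at h0
  rcases abs_eq_abs.1 h with h | h
  · obtain ⟨rfl, rfl⟩ := eq_and_eq_of_sin_sub_sin_eq hne h
    rfl
  · rw [neg_sub] at h
    obtain ⟨rfl, rfl⟩ := eq_and_eq_of_sin_sub_sin_eq hne h
    exact Set.pair_comm _ _
end

section
/- Let n ≥ 1 and let c₁, …, c_{2n} be natural numbers. Then there exist strictly increasing sequences (kᵢ)_{i=0}^{2n}, (ℓᵢ)_{i=0}^{2n}, and (mⱼ)_{j=0}^{n} of natural numbers, each with no two consecutive terms differing by exactly 1, and a sequence (Wᵢ)_{i=0}^{2n} of natural numbers, such that for i = 0, …, 2n: (1) Wⱼ is the best approximate of Wᵢ up to kⱼ (Wᵢ|_{kⱼ} = Wⱼ) for all j ≤ i; (2) kᵢ > max{c₁, …, c_{2n}}; and if i ≥ 1: (3) k_{i−1} < ℓᵢ < kᵢ; (4) kᵢ > Wᵢ and for all natural numbers Z, if Wᵢ is the best approximate of Z up to kᵢ (Z|_{kᵢ} = Wᵢ) then Best(k_{i−1}, ℓᵢ, W_{i−1}, Z, cᵢ) holds; (5) Next(k_{i−1},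 kᵢ) holds; (6) Next(ℓ_{i−1}, ℓᵢ) holds; and if i is odd: (7) k_{i−1} ≤ m_{(i−1)/2} < kᵢ; (8) Next(m_{(i−1)/2 − 1}, m_{(i−1)/2}) holds when i > 1. -/
/-- `BestApp X d Y` says that `Y` is the best approximate of `X` up to `d`
(written `X|_d = Y`): `Y ≤ d`, `sin Y ≤ sin X`, and for every `Z ≤ d` with
`Z ≠ Y` and `sin Z ≤ sin X` one has `sin Z < sin Y`. -/
def BestApp (X d Y : ℕ) : Prop :=
  Y ≤ d ∧ Real.sin Y ≤ Real.sin X ∧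
    ∀ Z : ℕ, Z ≤ d → Z ≠ Y → Real.sin Z ≤ Real.sin X → Real.sin Z < Real.sin Y


/-- `Next X₁ X₂` holds iff `X₁ < X₂`, `sin X₁ < sin X₂`, and for every `Z < X₂`
either `sin Z ≤ sin X₁` or `sin X₂ < sin Z`. -/
def Next (X₁ X₂ : ℕ) : Prop :=
  X₁ < X₂ ∧ Real.sin X₁ < Real.sin X₂ ∧
    ∀ Z : ℕ, Z < X₂ → Real.sin Z ≤ Real.sin X₁ ∨ Real.sin X₂ < Real.sin Z

/-- `g (X₁, X₂, Y₁, Y₂) = |sin X₂ − sin X₁ − |sin Y₂ − sin Y₁||`. -/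
noncomputable def gFn (X₁ X₂ Y₁ Y₂ : ℕ) : ℝ :=
  abs (Real.sin X₂ - Real.sin X₁ - abs (Real.sin Y₂ - Real.sin Y₁))

/-- `Best d e X₁ X₂ Y₁` holds iff there is `Y₂` with `Y₁ ≤ d`, `Y₂ ≤ e`,
`Y₁ < Y₂`, and `g (X₁, X₂, Y₁, Y₂) < g (X₁, X₂, Z₁, Z₂)` for all `Z₁ ≤ d`,
`Z₂ ≤ e` with `{Z₁, Z₂} ≠ {Y₁, Y₂}` as sets. -/
def Best (d e X₁ X₂ Y₁ : ℕ) : Prop :=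
  ∃ Y₂ : ℕ, Y₁ ≤ d ∧ Y₂ ≤ e ∧ Y₁ < Y₂ ∧
    ∀ Z₁ Z₂ : ℕ, Z₁ ≤ d → Z₂ ≤ e → ({Z₁, Z₂} : Set ℕ) ≠ {Y₁, Y₂} →
      gFn X₁ X₂ Y₁ Y₂ < gFn X₁ X₂ Z₁ Z₂

section Transcendence
open Polynomial

theorem exists_prime_gt_mul_pow_div_factorial_lt_one (A c : ℝ) (M : ℕ) :
    ∃ p, M < p ∧ p.Prime ∧ A * (c ^ p / (p - 1).factorial) < 1 := by
  have h : Filter.Tendsto (fun q : ℕ => A * c * (c ^ q / q.factorial)) Filter.atTop (nhds 0) := by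
    simpa using (FloorSemiring.tendsto_pow_div_factorial_atTop c).const_mul (A * c)
  obtain ⟨N, hN⟩ := Filter.eventually_atTop.1 (h.eventually_lt_const one_pos)
  obtain ⟨p, hp, hprime⟩ := Nat.exists_infinite_primes (M + N + 1)
  refine ⟨p, by omega, hprime, ?_⟩
  have h1 := hN (p - 1) (by omega)
  have h2 : c ^ p = c ^ (p - 1) * c := by rw [← pow_succ]; congr 1; omega
  rw [h2]
  calc _ = _ := by ring
    _ < 1 := h1

theorem exists_aeval_natCast_mul_I_re (g : ℤ[X]) (k : ℕ) :
    ∃ u : ℤ, (aeval ((k : ℂ) * Complex.I) g).re = u := by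
  have h := aeval_algHom_apply GaussianInt.toComplex.toIntAlgHom (⟨0, k⟩ : GaussianInt) g
  have h2 : (GaussianInt.toComplex.toIntAlgHom (⟨0, k⟩ : GaussianInt)) = (k : ℂ) * Complex.I := by
    simp [GaussianInt.toComplex_def]
  rw [h2] at h
  refine ⟨(aeval (⟨0, k⟩ : GaussianInt) g).re, ?_⟩
  rw [h]
  exact (GaussianInt.intCast_re _).symm

theorem eq_zero_of_aeval_exp_I {P : ℤ[X]} (hP : aeval (Complex.exp Complex.I) P = 0) : P = 0 := by
  by_contra hP0
  obtain ⟨Q, hQ, hdvd⟩ := P.exists_eq_pow_rootMultiplicity_mul_and_not_dvd hP0 0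
  have hQ0 : Q.coeff 0 ≠ 0 := by simpa [X_dvd_iff] using hdvd
  have hQe : aeval (Complex.exp Complex.I) Q = 0 := by
    rw [hQ] at hP
    simpa [Complex.exp_ne_zero] using hP
  set N := Q.natDegree
  set f : ℤ[X] := ∏ i ∈ Finset.range N, (X ^ 2 + C (((i : ℤ) + 1) ^ 2)) with hf
  have hf0 : f.eval 0 ≠ 0 := by
    rw [hf, eval_prod, Finset.prod_ne_zero_iff]
    intro i _
    simp
    omega
  have hfne : f ≠ 0 := by rintro h; simp [h] at hf0
  have hroot : ∀ i ∈ Finset.range N, ((i + 1 : ℕ) : ℂ) * Complex.I ∈ f.aroots ℂ := by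
    intro i hi
    rw [mem_aroots]
    refine ⟨hfne, ?_⟩
    rw [hf, map_prod]
    refine Finset.prod_eq_zero hi ?_
    simp [mul_pow]
  obtain ⟨c, hc⟩ := LindemannWeierstrass.exp_polynomial_approx f hf0
  obtain ⟨p, hpM, hp, hsmall⟩ := exists_prime_gt_mul_pow_div_factorial_lt_one
    (∑ i ∈ Finset.range N, ‖(Q.coeff (i + 1) : ℂ)‖) c ((f.eval 0).natAbs + (Q.coeff 0).natAbs)
  obtain ⟨n, hn, g, -, hg⟩ := hc p (by omega) hp
  have hexp : ∀ i : ℕ, Complex.exp (((i + 1 : ℕ) : ℂ) * Complex.I)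
      = Complex.exp Complex.I ^ (i + 1) := fun i => by rw [← Complex.exp_nat_mul]
  rw [aeval_eq_sum_range, Finset.sum_range_succ'] at hQe
  choose u hu using exists_aeval_natCast_mul_I_re g
  set S : ℂ := ∑ i ∈ Finset.range N, (Q.coeff (i + 1) : ℂ) *
    (n • Complex.exp (((i + 1 : ℕ) : ℂ) * Complex.I)
      - p • aeval (((i + 1 : ℕ) : ℂ) * Complex.I) g) with hS
  have hSnorm : ‖S‖ < 1 := by
    refine lt_of_le_of_lt ?_ hsmall
    rw [Finset.sum_mul]
    refine (norm_sum_le _ _).trans (Finset.sum_le_sum fun i hi => ?_)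
    rw [norm_mul]
    exact mul_le_mul_of_nonneg_left (hg (hroot i hi)) (norm_nonneg _)
  have hSeq : S = -((Q.coeff 0 * n : ℤ) : ℂ)
      - p * ∑ i ∈ Finset.range N, (Q.coeff (i + 1) : ℂ) * aeval (((i + 1 : ℕ) : ℂ) * Complex.I) g := by
    have h1 : ∑ i ∈ Finset.range N, (Q.coeff (i + 1) : ℂ) * Complex.exp Complex.I ^ (i + 1)
        = -(Q.coeff 0 : ℂ) := by
      simp only [zsmul_eq_mul, pow_zero, mul_one] at hQe
      exact eq_neg_of_add_eq_zero_left hQe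
    calc S = n * ∑ i ∈ Finset.range N, (Q.coeff (i + 1) : ℂ) * Complex.exp Complex.I ^ (i + 1)
        - p * ∑ i ∈ Finset.range N,
          (Q.coeff (i + 1) : ℂ) * aeval (((i + 1 : ℕ) : ℂ) * Complex.I) g := by
          rw [hS, Finset.mul_sum, Finset.mul_sum, ← Finset.sum_sub_distrib]
          refine Finset.sum_congr rfl fun i _ => ?_
          rw [hexp, zsmul_eq_mul, nsmul_eq_mul]
          ring
      _ = _ := by rw [h1]; push_cast; ring
  set T : ℤ := -(Q.coeff 0 * n) - p * ∑ i ∈ Finset.range N, Q.coeff (i + 1) * u (i + 1) with hT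
  have hST : S.re = T := by
    rw [hSeq, hT, Complex.sub_re, Complex.neg_re, Complex.intCast_re, ← Complex.ofReal_natCast,
      Complex.re_ofReal_mul, Complex.re_sum]
    push_cast
    congr 2
    refine Finset.sum_congr rfl fun i _ => ?_
    rw [← Complex.ofReal_intCast, Complex.re_ofReal_mul, ← hu]
    push_cast
    rfl
  have hT0 : T = 0 := by
    have : |(T : ℝ)| < 1 := by
      rw [← hST]
      exact (Complex.abs_re_le_norm S).trans_lt hSnorm
    exact Int.abs_lt_one_iff.1 (by exact_mod_cast this)
  have hdvd' : (p : ℤ) ∣ Q.coeff 0 * n :=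
    ⟨-∑ i ∈ Finset.range N, Q.coeff (i + 1) * u (i + 1), by linarith⟩
  rcases Int.Prime.dvd_mul' hp hdvd' with h | h
  · have := Nat.le_of_dvd (Int.natAbs_pos.2 hQ0) (Int.natCast_dvd.1 h)
    omega
  · exact hn h

end Transcendence

/-- Linear independence over `ℚ` of the values `sin 1, sin 2, …`, for sums of two terms. -/
theorem eq_or_eq_of_sin_add_sin_eq {a b c d : ℕ}
    (h : Real.sin a + Real.sin d = Real.sin b + Real.sin c) :
    (a = b ∧ d = c) ∨ (a = c ∧ d = b) := by
  classical
  set N := a + b + c + d with hN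
  set z := Complex.exp Complex.I with hz
  have key : ∀ x ≤ N, z ^ (N + x) - z ^ (N - x) = 2 * Complex.I * z ^ N * (Real.sin x : ℝ) := by
    intro x hx
    have h1 : z ^ (N - x) * z ^ x = z ^ N := by rw [← pow_add, Nat.sub_add_cancel hx]
    have h2 : Complex.exp (x * Complex.I) = z ^ x := Complex.exp_nat_mul _ _
    have h3 : Complex.exp (-x * Complex.I) * z ^ x = 1 := by
      rw [← h2, ← Complex.exp_add]; simp
    have h4 : z ^ (N - x) = z ^ N * Complex.exp (-x * Complex.I) := by
      rw [← h1, mul_assoc, mul_comm (z ^ x), h3, mul_one]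
    rw [h4, Complex.ofReal_sin, Complex.sin, Complex.ofReal_natCast, h2, pow_add]
    linear_combination (z ^ N * z ^ x - z ^ N * Complex.exp (-x * Complex.I)) * Complex.I_mul_I
  open Polynomial in
  have hpoly := eq_zero_of_aeval_exp_I (P := (X ^ (N + a) - X ^ (N - a)) + (X ^ (N + d) - X ^ (N - d))
    - ((X ^ (N + b) - X ^ (N - b)) + (X ^ (N + c) - X ^ (N - c)))) (by
      simp only [map_add, map_sub, map_pow, Polynomial.aeval_X, ← hz]
      rw [key a (by omega), key b (by omega), key c (by omega), key d (by omega)]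
      have : (Real.sin a : ℂ) + Real.sin d = Real.sin b + Real.sin c := by exact_mod_cast h
      linear_combination (2 * Complex.I * z ^ N) * this)
  have hcoeff (j : ℕ) (hj : 0 < j) : ((if j = a then 1 else 0) + (if j = d then 1 else 0) : ℤ)
      = (if j = b then 1 else 0) + (if j = c then 1 else 0) := by
    have h1 (x : ℕ) : N + j ≠ N - x := by omega
    have h2 := congrArg (fun P => Polynomial.coeff P (N + j)) hpoly
    simp only [Polynomial.coeff_add, Polynomial.coeff_sub, Polynomial.coeff_X_pow,
      Polynomial.coeff_zero, h1, if_false, sub_zero, Nat.add_left_cancel_iff] at h2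
    exact sub_eq_zero.1 h2
  have ha := hcoeff a
  have hb := hcoeff b
  have hc := hcoeff c
  have hd := hcoeff d
  clear hcoeff hpoly key h hN hz
  clear_value N z
  grind

theorem sin_natCast_injective : Function.Injective fun n : ℕ => Real.sin n := by
  intro a b h
  have := @eq_or_eq_of_sin_add_sin_eq a b 0 0 (by simpa using h)
  omega

theorem sin_natCast_lt_one (n : ℕ) : Real.sin n < 1 := by
  refine lt_of_le_of_ne (Real.sin_le_one _) fun h => ?_
  obtain ⟨k, hk⟩ := Real.sin_eq_one_iff.1 h
  have h4 : (4 * k + 1 : ℤ) ≠ 0 := by omega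
  refine irrational_pi ⟨2 * n / (4 * k + 1 : ℤ), ?_⟩
  have h5 : ((4 * k + 1 : ℤ) : ℝ) ≠ 0 := by exact_mod_cast h4
  rw [Rat.cast_div, Rat.cast_intCast, div_eq_iff h5]
  push_cast
  linarith

theorem exists_sin_natCast_mem_Ioo {a b : ℝ} (hab : a < b) (ha : -1 ≤ a) (hb : b ≤ 1) :
    ∃ n : ℕ, Real.sin n ∈ Set.Ioo a b := by
  have : Fact (0 < 2 * Real.pi) := ⟨Real.two_pi_pos⟩
  have hirr : Irrational (1 / (2 * Real.pi)) := by
    rw [one_div, irrational_inv_iff]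
    exact_mod_cast irrational_pi.natCast_mul (m := 2) (by norm_num)
  have hd := AddCircle.denseRange_zsmul_coe_iff.2 hirr
  rw [denseRange_zsmul_iff_nsmul] at hd
  obtain ⟨x, hx⟩ := hd.exists_mem_open (s := Real.Angle.sin ⁻¹' Set.Ioo a b)
    (isOpen_Ioo.preimage Real.Angle.continuous_sin)
    ⟨(Real.arcsin ((a + b) / 2) : Real.Angle), by
      simp only [Set.mem_preimage, Real.Angle.sin_coe]
      rw [Real.sin_arcsin (by linarith) (by linarith)]
      constructor <;> linarith⟩
  refine ⟨x, ?_⟩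
  have h2 : (x • ((1 : ℝ) : AddCircle (2 * Real.pi))) = ((x : ℝ) : Real.Angle) := by
    rw [← AddCircle.coe_nsmul, nsmul_one]
    rfl
  rw [h2] at hx
  simpa using hx

theorem exists_pos_forall_lt (s : Finset ℝ) : ∃ e > 0, ∀ y ∈ s, 0 < y → e < y := by
  induction s using Finset.induction_on with
  | empty => exact ⟨1, one_pos, by simp⟩
  | insert a s _ ih =>
    obtain ⟨e, he, h⟩ := ih
    by_cases ha : 0 < a
    · refine ⟨min e (a / 2), by positivity, fun y hy hy0 => ?_⟩
      rcases Finset.mem_insert.1 hy with rfl | hy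
      · exact (min_le_right _ _).trans_lt (by linarith)
      · exact (min_le_left _ _).trans_lt (h y hy hy0)
    · refine ⟨e, he, fun y hy hy0 => ?_⟩
      rcases Finset.mem_insert.1 hy with rfl | hy
      · exact absurd hy0 ha
      · exact h y hy hy0

theorem exists_pos_forall_add_lt_sin (x : ℝ) (N : ℕ) :
    ∃ e > 0, ∀ Z ≤ N, x < Real.sin Z → x + e < Real.sin Z := by
  obtain ⟨e, he, h⟩ := exists_pos_forall_lt
    ((Finset.range (N + 1)).image fun Z : ℕ => Real.sin Z - x)
  refine ⟨e, he, fun Z hZ hx => ?_⟩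
  have := h (Real.sin Z - x) (Finset.mem_image_of_mem _ (by simpa [Nat.lt_succ_iff] using hZ))
    (by linarith)
  linarith

theorem exists_next (X N : ℕ) {η : ℝ} (hη : 0 < η) :
    ∃ Y, N < Y ∧ Next X Y ∧ Real.sin Y < Real.sin X + η := by
  classical
  obtain ⟨e, he, h⟩ := exists_pos_forall_add_lt_sin (Real.sin X) (max N X)
  have h1 := sin_natCast_lt_one X
  have hex : ∃ Y : ℕ, Real.sin X < Real.sin Y ∧
      Real.sin Y < Real.sin X + min (min e η) (1 - Real.sin X) :=
    exists_sin_natCast_mem_Ioo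
      (by have : 0 < min (min e η) (1 - Real.sin X) := by
            have : 0 < 1 - Real.sin X := by linarith
            positivity
          linarith)
      (Real.neg_one_le_sin _) (by linarith [min_le_right (min e η) (1 - Real.sin X)])
  obtain ⟨hlo, hhi⟩ := Nat.find_spec hex
  have hmin := fun Z => @Nat.find_min _ _ hex Z
  set Y := Nat.find hex
  have hle := min_le_left (min e η) (1 - Real.sin X)
  have hY : max N X < Y := by
    by_contra! hc
    linarith [h Y hc hlo, min_le_left e η]
  refine ⟨Y, by omega, ⟨by omega, hlo, fun Z hZ => ?_⟩, by linarith [min_le_right e η]⟩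
  by_contra! hc
  exact hmin Z hZ ⟨hc.1, hc.2.trans_lt hhi⟩

theorem BestApp.trans {X X' Y d d' : ℕ} (h : BestApp X' d X) (h' : BestApp X d' Y) (hd : d' ≤ d) :
    BestApp X' d' Y := by
  refine ⟨h'.1, h'.2.1.trans h.2.1, fun Z hZ hne hle => h'.2.2 Z hZ hne ?_⟩
  rcases eq_or_ne Z X with rfl | hX
  · exact le_rfl
  · exact (h.2.2 Z (hZ.trans hd) hX hle).le

theorem BestApp.refl {X d : ℕ} (h : X ≤ d) : BestApp X d X :=
  ⟨h, le_rfl, fun _ _ hne hle => hle.lt_of_ne fun he => hne (sin_natCast_injective he)⟩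

theorem pair_eq_of_abs_sin_sub_eq {Z₁ Z₂ a b : ℕ} (hab : a ≠ b)
    (h : |Real.sin Z₂ - Real.sin Z₁| = |Real.sin b - Real.sin a|) :
    ({Z₁, Z₂} : Set ℕ) = {a, b} := by
  rcases abs_eq_abs.1 h with h | h
  · rcases eq_or_eq_of_sin_add_sin_eq (a := Z₂) (d := a) (b := b) (c := Z₁) (by linarith) with
      ⟨rfl, rfl⟩ | ⟨-, h⟩
    · rfl
    · exact absurd h hab
  · rcases eq_or_eq_of_sin_add_sin_eq (a := Z₂) (d := b) (b := a) (c := Z₁) (by linarith) with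
      ⟨rfl, rfl⟩ | ⟨-, h⟩
    · exact Set.pair_comm _ _
    · exact absurd h.symm hab

theorem exists_forall_best {a b d e : ℕ} (had : a ≤ d) (hbe : b ≤ e) (hab : a < b) :
    ∃ ε > 0, ∀ W Z : ℕ, |Real.sin Z - Real.sin W - (|Real.sin b - Real.sin a|)| < ε →
      Best d e W Z a := by
  set δ := |Real.sin b - Real.sin a|
  obtain ⟨ε, hε, h⟩ := exists_pos_forall_lt
    ((Finset.range (d + 1) ×ˢ Finset.range (e + 1)).image
      fun p : ℕ × ℕ => |(|Real.sin p.2 - Real.sin p.1|) - δ|)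
  refine ⟨ε / 2, by positivity, fun W Z hWZ => ⟨b, had, hbe, hab, fun Z₁ Z₂ h₁ h₂ hne => ?_⟩⟩
  have hpos : 0 < |(|Real.sin Z₂ - Real.sin Z₁|) - δ| :=
    abs_pos.2 (sub_ne_zero.2 fun he => hne (pair_eq_of_abs_sin_sub_eq hab.ne he))
  have hlt := h _ (Finset.mem_image.2 ⟨(Z₁, Z₂), by simp; omega, rfl⟩) hpos
  simp only [gFn]
  have htri := abs_sub_le (|Real.sin Z₂ - Real.sin Z₁|) (Real.sin Z - Real.sin W) δ
  rw [abs_sub_comm _ (Real.sin Z - Real.sin W)] at htri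
  dsimp only at hlt
  change |Real.sin Z - Real.sin W - δ| < _
  linarith

theorem exists_bestApp_forall_best {k W a b e : ℕ} (hW : W ≤ k) (ha : a ≤ k) (hab : a < b)
    (hbe : b ≤ e) (hgap : ∀ Z ≤ k, Real.sin W < Real.sin Z →
      Real.sin W + |Real.sin b - Real.sin a| < Real.sin Z)
    (hone : Real.sin W + |Real.sin b - Real.sin a| < 1) :
    ∃ W' V : ℕ, BestApp W' k W ∧
      ∀ k' ≥ V, ∀ Z, BestApp Z k' W' → Best k e W Z a := by
  obtain ⟨ε, hε, hbest⟩ := exists_forall_best ha hbe hab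
  have hδ : 0 < |Real.sin b - Real.sin a| :=
    abs_pos.2 (sub_ne_zero.2 fun he => hab.ne' (sin_natCast_injective he))
  set δ := |Real.sin b - Real.sin a|
  have hm1 := Real.neg_one_le_sin W
  obtain ⟨W', hlo, hhi⟩ := exists_sin_natCast_mem_Ioo
    (a := max (Real.sin W) (Real.sin W + δ - ε)) (b := Real.sin W + δ)
    (max_lt (by linarith) (by linarith)) (hm1.trans (le_max_left _ _)) hone.le
  obtain ⟨V, hVlo, hVhi⟩ := exists_sin_natCast_mem_Ioo
    (a := Real.sin W + δ) (b := min (Real.sin W + δ + ε) 1)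
    (lt_min (by linarith) hone) (by linarith) (min_le_right _ _)
  rw [max_lt_iff] at hlo
  rw [lt_min_iff] at hVhi
  refine ⟨W', V, ⟨hW, hlo.1.le, fun Z hZ hne hle => ?_⟩, fun k' hk' Z hZ => ?_⟩
  · by_contra! hc
    have := hgap Z hZ (hc.lt_of_ne fun he => hne (sin_natCast_injective he).symm)
    linarith
  · refine hbest W Z (abs_lt.2 ⟨by linarith [hZ.2.1], ?_⟩)
    by_contra! hc
    have := hZ.2.2 V hk' (by rintro rfl; linarith) (by linarith)
    linarith

/-- The values `kᵢ, ℓᵢ, Wᵢ` at one stage of the construction, together with the most recently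
chosen term `m` of the third sequence. -/
structure EncodingState where
  k : ℕ
  ℓ : ℕ
  m : ℕ
  W : ℕ

/-- `EncodingStep c newM s t` says that `t` may follow `s` when encoding `c`; a new term of the
third sequence is chosen exactly when `newM` holds. -/
structure EncodingStep (c : ℕ) (newM : Prop) (s t : EncodingState) : Prop where
  k_lt : s.k + 1 < t.k
  ℓ_lt : s.ℓ + 1 < t.ℓ
  k_lt_ℓ : s.k < t.ℓ
  ℓ_lt_k : t.ℓ < t.k
  W_lt : t.W < t.k
  bestApp : BestApp t.W s.k s.W
  best : ∀ Z, BestApp Z t.k t.W → Best s.k t.ℓ s.W Z c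
  next_k : Next s.k t.k
  next_ℓ : Next s.ℓ t.ℓ
  new_m : newM → s.m + 1 < t.m ∧ s.k ≤ t.m ∧ t.m < t.k ∧ Next s.m t.m
  keep_m : ¬ newM → t.m = s.m

theorem exists_encodingStep {c : ℕ} (newM : Prop) {s : EncodingState} (hc : c ≤ s.k)
    (hW : s.W ≤ s.k) : ∃ t, EncodingStep c newM s t := by
  obtain ⟨e, he, hgap⟩ := exists_pos_forall_add_lt_sin (Real.sin s.W) s.k
  have hone : 0 < 1 - Real.sin s.W := by linarith [sin_natCast_lt_one s.W]
  obtain ⟨b, hcb, ⟨-, hsin, -⟩, hb⟩ :=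
    exists_next c c (η := min e (1 - Real.sin s.W)) (by positivity)
  have habs : |Real.sin b - Real.sin c| < min e (1 - Real.sin s.W) := by
    rw [abs_of_pos (by linarith)]; linarith
  rw [lt_min_iff] at habs
  obtain ⟨ℓ, hℓ, hnextℓ, -⟩ := exists_next s.ℓ (s.k + s.ℓ + b + 1) one_pos
  obtain ⟨W, V, hbest, hbest'⟩ := exists_bestApp_forall_best (e := ℓ) hW hc hcb (by omega)
    (fun Z hZ hlt => by linarith [hgap Z hZ hlt]) (by linarith)
  obtain ⟨m, hmnew, hmkeep⟩ : ∃ m,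
      (newM → s.m + 1 < m ∧ s.k ≤ m ∧ Next s.m m) ∧ (¬ newM → m = s.m) := by
    by_cases h : newM
    · obtain ⟨m, hm, hnext, -⟩ := exists_next s.m (s.m + 1 + s.k) one_pos
      exact ⟨m, fun _ => ⟨by omega, by omega, hnext⟩, fun h' => absurd h h'⟩
    · exact ⟨s.m, fun h' => absurd h' h, fun _ => rfl⟩
  obtain ⟨k, hk, hnextk, -⟩ := exists_next s.k (s.k + ℓ + W + V + m + 1) one_pos
  refine ⟨⟨k, ℓ, m, W⟩, ?_⟩
  constructor <;> dsimp only
  · omega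
  · omega
  · omega
  · omega
  · omega
  · exact hbest
  · exact hbest' k (by omega)
  · exact hnextk
  · exact hnextℓ
  · exact fun h => ⟨(hmnew h).1, (hmnew h).2.1, by omega, (hmnew h).2.2⟩
  · exact hmkeep

theorem exists_encodingStep_seq (c : ℕ → ℕ) (newM : ℕ → Prop) (M : ℕ) (hc : ∀ i, c i ≤ M) :
    ∃ s : ℕ → EncodingState, (∀ i, M < (s i).k) ∧ (∀ i, (s i).W ≤ (s i).k) ∧
      ∀ i, EncodingStep (c i) (newM i) (s i) (s (i + 1)) := by
  have hstep (i : ℕ) (s : {s : EncodingState // M < s.k ∧ s.W ≤ s.k}) :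
      ∃ t : {s : EncodingState // M < s.k ∧ s.W ≤ s.k}, EncodingStep (c i) (newM i) s t := by
    obtain ⟨t, ht⟩ := exists_encodingStep (newM i) ((hc i).trans s.2.1.le) s.2.2
    exact ⟨⟨t, by have := s.2.1; have := ht.k_lt; omega, ht.W_lt.le⟩, ht⟩
  choose next hnext using hstep
  let s : ℕ → {s : EncodingState // M < s.k ∧ s.W ≤ s.k} :=
    fun i => Nat.rec ⟨⟨M + 1, 0, 0, 0⟩, by simp⟩ next i
  exact ⟨fun i => (s i).1, fun i => (s i).2.1, fun i => (s i).2.2, fun i => hnext i (s i)⟩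

/-- **Lemma 3.14.** Given `n ≥ 1` and naturals `c 1, …, c (2n)`, there are
strictly increasing sequences `(k i)_{i=0}^{2n}`, `(ℓ i)_{i=0}^{2n}`,
`(m j)_{j=0}^{n}` of nonconsecutive naturals (no two consecutive terms differ
by exactly `1`) and a sequence `(W i)_{i=0}^{2n}` satisfying properties
(1)–(8). -/
theorem exists_encoding_sequences (n : ℕ) (hn : 1 ≤ n) (c : ℕ → ℕ) :
    ∃ k ℓ m W : ℕ → ℕ,
      (∀ i, i + 1 ≤ 2 * n → k i < k (i + 1) ∧ k (i + 1) ≠ k i + 1) ∧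
      (∀ i, i + 1 ≤ 2 * n → ℓ i < ℓ (i + 1) ∧ ℓ (i + 1) ≠ ℓ i + 1) ∧
      (∀ j, j + 1 ≤ n → m j < m (j + 1) ∧ m (j + 1) ≠ m j + 1) ∧
      (∀ i, i ≤ 2 * n →
        (∀ j, j ≤ i → BestApp (W i) (k j) (W j)) ∧
        (∀ a, 1 ≤ a → a ≤ 2 * n → k i > c a)) ∧
      (∀ i, 1 ≤ i → i ≤ 2 * n →
        (k (i - 1) < ℓ i ∧ ℓ i < k i) ∧
        (k i > W i ∧
          ∀ Z : ℕ, BestApp Z (k i) (W i) → Best (k (i - 1)) (ℓ i) (W (i - 1)) Z (c i)) ∧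
        Next (k (i - 1)) (k i) ∧
        Next (ℓ (i - 1)) (ℓ i)) ∧
      (∀ i, 1 ≤ i → i ≤ 2 * n → i % 2 = 1 →
        (k (i - 1) ≤ m ((i - 1) / 2) ∧ m ((i - 1) / 2) < k i) ∧
        (1 < i → Next (m ((i - 1) / 2 - 1)) (m ((i - 1) / 2)))) := by
  set M := ∑ a ∈ Finset.range (2 * n + 1), c a
  have hcM (a : ℕ) (ha : a ≤ 2 * n) : c a ≤ M :=
    Finset.single_le_sum (f := c) (fun _ _ => Nat.zero_le _) (by simpa [Nat.lt_succ_iff] using ha)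
  obtain ⟨s, hM, hW, hs⟩ := exists_encodingStep_seq (fun i => min (c (i + 1)) M) Even M
    fun i => min_le_right _ _
  have hmono : Monotone fun i => (s i).k :=
    monotone_nat_of_le_succ fun i => by have := (hs i).k_lt; omega
  have hm_even (j : ℕ) := (hs (2 * j)).new_m (even_two_mul j)
  have hm_odd (j : ℕ) : (s (2 * j + 2)).m = (s (2 * j + 1)).m :=
    (hs (2 * j + 1)).keep_m (by simp)
  refine ⟨fun i => (s i).k, fun i => (s i).ℓ, fun j => (s (2 * j + 1)).m, fun i => (s i).W,
    fun i _ => ?_, fun i _ => ?_, fun j _ => ?_, fun i _ => ⟨fun j hj => ?_, fun a _ ha => ?_⟩,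
    fun i hi hin => ?_, fun i _ _ hodd => ?_⟩
  · have := (hs i).k_lt
    dsimp only; omega
  · have := (hs i).ℓ_lt
    dsimp only; omega
  · have := (hm_even (j + 1)).1
    rw [mul_add, mul_one, hm_odd] at this
    dsimp only
    rw [mul_add, mul_one]
    omega
  · induction i, hj using Nat.le_induction with
    | base => exact .refl (hW j)
    | succ i hj ih => exact (hs i).bestApp.trans (ih (by omega)) (hmono hj)
  · exact (hcM a ha).trans_lt (hM i)
  · obtain ⟨i, rfl⟩ := Nat.exists_eq_add_of_le' hi
    have h := hs i
    simp only [min_eq_left (hcM _ hin)] at h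
    exact ⟨⟨h.k_lt_ℓ, h.ℓ_lt_k⟩, ⟨h.W_lt, h.best⟩, h.next_k, h.next_ℓ⟩
  · obtain ⟨j, rfl⟩ : ∃ j, i = 2 * j + 1 := ⟨i / 2, by omega⟩
    have hdiv (j : ℕ) : 2 * j / 2 = j := by omega
    simp only [Nat.add_sub_cancel, hdiv]
    refine ⟨⟨(hm_even j).2.1, (hm_even j).2.2.1⟩, fun hlt => ?_⟩
    obtain ⟨j, rfl⟩ := Nat.exists_eq_add_of_le' (show 1 ≤ j by omega)
    have := (hm_even (j + 1)).2.2.2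
    rw [mul_add, mul_one, hm_odd] at this
    exact this
end

section
/- Let S ⊆ ℕ² be a finite set. Then there exist natural numbers X₁, X₂, X₃, X₄ such that for all natural numbers s, t: (s, t) ∈ S if and only if Member(X₁, X₂, X₃, X₄, s, t) holds. -/
/-- The relation **Admissible** (Definition 3.15). -/
def Admissible (d₁ d₂ d₃ d₄ e₁ e₂ X₁ X₂ X₃ X₄ s t : ℕ) : Prop :=
  (d₁ < d₂ ∧ d₂ < d₃ ∧
    BestApp X₁ d₁ d₁ ∧ BestApp X₁ d₂ d₂ ∧ BestApp X₁ d₃ d₃ ∧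
    BestApp X₁ (d₂ - 1) d₁ ∧ BestApp X₁ (d₃ - 1) d₂) ∧
  (d₁ ≤ d₄ ∧ d₄ < d₂ ∧ BestApp X₃ d₄ d₄) ∧
  (d₁ ≤ e₁ ∧ e₁ < d₂ ∧ d₂ ≤ e₂ ∧ e₂ < d₃ ∧
    BestApp X₂ e₁ e₁ ∧ BestApp X₂ e₂ e₂) ∧
  (∃ Y₁ : ℕ, BestApp X₄ d₁ Y₁ ∧ Best d₁ e₁ Y₁ X₄ s) ∧
  (∃ Y₃ : ℕ, BestApp X₄ d₂ Y₃ ∧ Best d₂ e₂ Y₃ X₄ t)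

/-- The relation **Member** (Definition 3.15). -/
def Member (X₁ X₂ X₃ X₄ s t : ℕ) : Prop :=
  ∃ d₁ d₂ d₃ d₄ e₁ e₂ : ℕ, Admissible d₁ d₂ d₃ d₄ e₁ e₂ X₁ X₂ X₃ X₄ s t

theorem exists_intCast_re_aeval_intCast_mul_I (p : Polynomial ℤ) (m : ℤ) :
    ∃ z : ℤ, (Polynomial.aeval ((m : ℂ) * Complex.I) p).re = z := by
  have hm : (m : ℂ) * Complex.I = GaussianInt.toComplex ⟨0, m⟩ := by
    simp [GaussianInt.toComplex_def]
  refine ⟨(Polynomial.aeval (⟨0, m⟩ : GaussianInt) p).re, ?_⟩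
  rw [hm, Polynomial.aeval_def, Polynomial.aeval_def, GaussianInt.intCast_re,
    Polynomial.hom_eval₂]
  congr 2
  exact RingHom.ext_int _ _

theorem linearIndependent_cexp_intCast_mul_I :
    LinearIndependent ℤ (fun k : ℤ => Complex.exp (k * Complex.I)) := by
  rw [linearIndependent_iff']
  intro s g hg k₀ hk₀
  by_contra hne
  let r : ℤ → ℂ := fun k => ((k - k₀ : ℤ) : ℂ) * Complex.I
  have hrel : ∑ k ∈ s, (g k : ℂ) * Complex.exp (r k) = 0 := by
    have h := congrArg (fun z => z * Complex.exp (-(k₀ * Complex.I))) hg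
    simp only [Finset.sum_mul, zero_mul] at h
    rw [← h]
    refine Finset.sum_congr rfl fun k _ => ?_
    rw [zsmul_eq_mul, mul_assoc, ← Complex.exp_add]
    congr 2
    simp only [r]
    push_cast
    ring
  rw [← Finset.add_sum_erase s _ hk₀] at hrel
  let f : Polynomial ℤ :=
    ∏ k ∈ s.erase k₀, (Polynomial.X ^ 2 + Polynomial.C ((k - k₀) ^ 2))
  have hf : f.eval 0 ≠ 0 := by
    simp only [f, Polynomial.eval_prod]
    refine Finset.prod_ne_zero_iff.2 fun k hk => ?_
    simpa [sub_eq_zero] using Finset.ne_of_mem_erase hk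
  have hroot : ∀ k ∈ s.erase k₀, r k ∈ f.aroots ℂ := by
    intro k hk
    rw [Polynomial.mem_aroots]
    refine ⟨fun h => hf (by simp [h]), ?_⟩
    simp only [f, map_prod]
    refine Finset.prod_eq_zero hk ?_
    simp only [r, map_add, map_pow, Polynomial.aeval_X, mul_pow, Complex.I_sq]
    simp
  obtain ⟨c, hc⟩ := LindemannWeierstrass.exp_polynomial_approx f hf
  let A : ℝ := ∑ k ∈ s.erase k₀, |(g k : ℝ)|
  have hlim : Filter.Tendsto (fun n : ℕ => A * (c * (c ^ n / n.factorial))) Filter.atTop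
      (nhds 0) := by
    simpa using ((FloorSemiring.tendsto_pow_div_factorial_atTop c).const_mul c).const_mul A
  obtain ⟨N, hN⟩ := Filter.eventually_atTop.1 (hlim.eventually_lt_const one_pos)
  obtain ⟨p, hp, hpp⟩ :=
    Nat.exists_infinite_primes (N + (f.eval 0).natAbs + (g k₀).natAbs + 1)
  obtain ⟨n, hn, gp, -, hgp⟩ := hc p (by omega) hpp
  have hbound : A * (c ^ p / (p - 1).factorial) < 1 := by
    have h := hN (p - 1) (by omega)
    obtain ⟨q, rfl⟩ : ∃ q, p = q + 1 := ⟨p - 1, by omega⟩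
    simp only [Nat.add_sub_cancel] at h ⊢
    rwa [pow_succ', mul_div_assoc]
  choose z hz using fun k : ℤ => exists_intCast_re_aeval_intCast_mul_I gp (k - k₀)
  let E : ℂ := ∑ k ∈ s.erase k₀,
    (g k : ℂ) * (n • Complex.exp (r k) - p • Polynomial.aeval (r k) gp)
  have hE : ‖E‖ < 1 := by
    refine lt_of_le_of_lt (norm_sum_le _ _) (lt_of_le_of_lt ?_ hbound)
    rw [Finset.sum_mul]
    refine Finset.sum_le_sum fun k hk => ?_
    rw [norm_mul, Complex.norm_intCast]
    exact mul_le_mul_of_nonneg_left (hgp (hroot k hk)) (abs_nonneg _)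
  have hsum : ((g k₀ * n : ℤ) : ℂ) +
      ∑ k ∈ s.erase k₀, ((p * g k : ℤ) : ℂ) * Polynomial.aeval (r k) gp = -E := by
    have hr₀ : Complex.exp (r k₀) = 1 := by simp [r]
    rw [hr₀] at hrel
    have h : ∑ k ∈ s.erase k₀, ((p * g k : ℤ) : ℂ) * Polynomial.aeval (r k) gp + E =
        n * ∑ k ∈ s.erase k₀, (g k : ℂ) * Complex.exp (r k) := by
      simp only [E, ← Finset.sum_add_distrib, Finset.mul_sum]
      refine Finset.sum_congr rfl fun k _ => ?_
      rw [zsmul_eq_mul, nsmul_eq_mul]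
      push_cast
      ring
    push_cast at h ⊢
    linear_combination h + (n : ℂ) * hrel
  have hre := congrArg Complex.re hsum
  rw [Complex.add_re, Complex.re_sum, Complex.intCast_re] at hre
  simp only [Complex.mul_re, Complex.intCast_re, Complex.intCast_im, zero_mul, sub_zero, r, hz] at hre
  have hint : g k₀ * n + ∑ k ∈ s.erase k₀, (p * g k) * z k = 0 := by
    rw [← Int.abs_lt_one_iff]
    have h : |((g k₀ * n + ∑ k ∈ s.erase k₀, (p * g k) * z k : ℤ) : ℝ)| < 1 := by
      rw [Int.cast_add, Int.cast_sum]
      simp only [Int.cast_mul _ (z _)]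
      rw [hre, Complex.neg_re, abs_neg]
      exact (Complex.abs_re_le_norm E).trans_lt hE
    exact_mod_cast h
  have hdvd : (p : ℤ) ∣ g k₀ * n := by
    rw [eq_neg_of_add_eq_zero_left hint, dvd_neg]
    exact Finset.dvd_sum fun k _ => ⟨g k * z k, by ring⟩
  rcases (Nat.prime_iff_prime_int.1 hpp).dvd_or_dvd hdvd with h | h
  · have := Nat.le_of_dvd (Int.natAbs_pos.2 hne) (Int.natCast_dvd.1 h)
    omega
  · exact hn h

theorem sin_natCast_add_sin_natCast_inj {a b c d : ℕ}
    (h : Real.sin a + Real.sin b = Real.sin c + Real.sin d) :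
    (a = c ∧ b = d) ∨ (a = d ∧ b = c) := by
  let v : ℕ → ℤ →₀ ℤ := fun n => Finsupp.single (n : ℤ) 1 - Finsupp.single (-n : ℤ) 1
  have hv : ∀ n : ℕ, Finsupp.linearCombination ℤ
      (fun k : ℤ => Complex.exp (k * Complex.I)) (v n) = 2 * Complex.I * (Real.sin n : ℝ) := by
    intro n
    have hI := Complex.I_sq
    simp only [v, map_sub, Finsupp.linearCombination_single, one_smul, Complex.ofReal_sin,
      Complex.sin, Complex.ofReal_natCast, Int.cast_neg, Int.cast_natCast]
    linear_combination (Complex.exp (n * Complex.I) - Complex.exp (-n * Complex.I)) * hI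
  have hzero : v a + v b - v c - v d = 0 := by
    refine (linearIndependent_iff.1 linearIndependent_cexp_intCast_mul_I) _ ?_
    simp only [map_sub, map_add, hv]
    have h' : ((Real.sin a : ℝ) : ℂ) + (Real.sin b : ℝ) = (Real.sin c : ℝ) + (Real.sin d : ℝ) := by
      exact_mod_cast h
    linear_combination 2 * Complex.I * h'
  have key : ∀ k : ℤ, 0 < k → (if (a : ℤ) = k then 1 else 0) + (if (b : ℤ) = k then 1 else 0) =
      (if (c : ℤ) = k then 1 else 0) + (if (d : ℤ) = k then (1 : ℤ) else 0) := by
    intro k hk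
    have hn : ∀ n : ℕ, (v n) k = if (n : ℤ) = k then 1 else 0 := by
      intro n
      have : ¬ (-(n : ℤ) = k) := by omega
      simp [v, Finsupp.single_apply, this]
    have h := DFunLike.congr_fun hzero k
    simp only [Finsupp.sub_apply, Finsupp.add_apply, hn, Finsupp.zero_apply] at h
    linarith
  have ha := key a
  have hb := key b
  have hc := key c
  have hd := key d
  grind

theorem abs_sin_sub_sin_natCast_inj {a b c d : ℕ} (hab : a ≠ b)
    (h : |Real.sin a - Real.sin b| = |Real.sin c - Real.sin d|) :
    ({c, d} : Set ℕ) = {a, b} := by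
  rw [Set.pair_eq_pair_iff]
  rcases abs_eq_abs.1 h with h | h
  · have := sin_natCast_add_sin_natCast_inj (a := a) (b := d) (c := b) (d := c) (by linarith)
    omega
  · have := sin_natCast_add_sin_natCast_inj (a := a) (b := c) (c := b) (d := d) (by linarith)
    omega

theorem denseRange_natCast_angle : DenseRange fun n : ℕ => ((n : ℝ) : Real.Angle) := by
  have h : Irrational ((1 : ℝ) / (2 * Real.pi)) := by
    rw [one_div, irrational_inv_iff]
    exact_mod_cast irrational_pi.natCast_mul two_ne_zero
  have h' := AddCircle.denseRange_zsmul_coe_iff.2 h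
  have : Fact (0 < 2 * Real.pi) := ⟨Real.two_pi_pos⟩
  rw [denseRange_zsmul_iff_nsmul] at h'
  have hfun : (fun n : ℕ => ((n : ℝ) : Real.Angle)) =
      fun n : ℕ => n • ((1 : ℝ) : AddCircle (2 * Real.pi)) := by
    funext n
    rw [← AddCircle.coe_nsmul, nsmul_one]
    rfl
  exact hfun ▸ h'

theorem exists_sin_natCast_mem_Ioo_s15 {x y : ℝ} (hx : -1 ≤ x) (hy : y ≤ 1) (hxy : x < y) :
    ∃ n : ℕ, Real.sin n ∈ Set.Ioo x y := by
  have hne : (Real.Angle.sin ⁻¹' Set.Ioo x y).Nonempty := by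
    refine ⟨(Real.arcsin ((x + y) / 2) : ℝ), ?_⟩
    rw [Set.mem_preimage, Real.Angle.sin_coe, Real.sin_arcsin (by linarith) (by linarith)]
    constructor <;> linarith
  obtain ⟨n, hn⟩ := denseRange_natCast_angle.exists_mem_open
    (isOpen_Ioo.preimage Real.Angle.continuous_sin) hne
  exact ⟨n, by simpa using hn⟩

theorem exists_sin_natCast_gap {x y : ℝ} (hxy : x < y) (N : ℕ) :
    ∃ a, x < a ∧ a ≤ y ∧ ∀ Z : ℕ, Z ≤ N → Real.sin Z < a → Real.sin Z ≤ x := by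
  induction N with
  | zero =>
    by_cases h : Real.sin (0 : ℕ) ≤ x
    · exact ⟨y, hxy, le_rfl, fun Z hZ _ => by rwa [Nat.le_zero.1 hZ]⟩
    · refine ⟨min y (Real.sin (0 : ℕ)), lt_min hxy (not_le.1 h), min_le_left _ _,
        fun Z hZ hlt => ?_⟩
      rw [Nat.le_zero.1 hZ] at hlt
      exact absurd (hlt.trans_le (min_le_right _ _)) (lt_irrefl _)
  | succ N ih =>
    obtain ⟨a, hxa, hay, ha⟩ := ih
    by_cases h : Real.sin (N + 1 : ℕ) ≤ x
    · refine ⟨a, hxa, hay, fun Z hZ hlt => ?_⟩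
      rcases Nat.le_succ_iff.1 hZ with hZ | rfl
      exacts [ha Z hZ hlt, h]
    · refine ⟨min a (Real.sin (N + 1 : ℕ)), lt_min hxa (not_le.1 h),
        (min_le_left _ _).trans hay, fun Z hZ hlt => ?_⟩
      rcases Nat.le_succ_iff.1 hZ with hZ | rfl
      · exact ha Z hZ (hlt.trans_le (min_le_left _ _))
      · exact absurd (hlt.trans_le (min_le_right _ _)) (lt_irrefl _)

theorem exists_gt_sin_natCast_mem_Ioo {x y : ℝ} (hx : -1 ≤ x) (hy : y ≤ 1) (hxy : x < y)
    (N : ℕ) : ∃ n : ℕ, N < n ∧ Real.sin n ∈ Set.Ioo x y := by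
  obtain ⟨a, hxa, hay, ha⟩ := exists_sin_natCast_gap hxy N
  obtain ⟨n, hxn, hna⟩ := exists_sin_natCast_mem_Ioo_s15 hx (hay.trans hy) hxa
  refine ⟨n, ?_, hxn, hna.trans_le hay⟩
  by_contra h
  exact absurd (ha n (not_lt.1 h) hna) (not_le.2 hxn)

theorem BestApp.unique {X m Y Y' : ℕ} (h : BestApp X m Y) (h' : BestApp X m Y') : Y = Y' := by
  by_contra hne
  exact lt_asymm (h.2.2 Y' h'.1 (Ne.symm hne) h'.2.1) (h'.2.2 Y h.1 hne h.2.1)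

/-- No natural number up to `N` has its sine strictly between `sin d` and `a`. -/
def SinGap (N d : ℕ) (a : ℝ) : Prop :=
  Real.sin d < a ∧ a ≤ 1 ∧ ∀ Z : ℕ, Z ≤ N → Real.sin Z < a → Real.sin Z ≤ Real.sin d

theorem SinGap.bestApp {N d m X : ℕ} {a : ℝ} (h : SinGap N d a)
    (hX : Real.sin X ∈ Set.Ico (Real.sin d) a) (hdm : d ≤ m) (hmN : m ≤ N) : BestApp X m d :=
  ⟨hdm, hX.1, fun Z hZ hne hle =>
    lt_of_le_of_ne (h.2.2 Z (hZ.trans hmN) (hle.trans_lt hX.2))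
      fun he => hne (sin_natCast_injective he)⟩

theorem SinGap.exists_shrink {M d : ℕ} {a : ℝ} (h : SinGap M d a) (N : ℕ) :
    ∃ a', a' ≤ a ∧ SinGap N d a' := by
  obtain ⟨a', hlt, hle, hgap⟩ := exists_sin_natCast_gap h.1 N
  exact ⟨a', hle, hlt, hle.trans h.2.1, hgap⟩

theorem SinGap.exists_next {M d : ℕ} {a : ℝ} (h : SinGap M d a) (N : ℕ) :
    ∃ (d' : ℕ) (a' : ℝ), N < d' ∧ SinGap d' d' a' ∧
      Set.Ico (Real.sin d') a' ⊆ Set.Ico (Real.sin d) a ∧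
      ∀ X : ℕ, Real.sin X ∈ Set.Ico (Real.sin d') a' →
        ∀ m, d ≤ m → m < d' → BestApp X m d := by
  classical
  obtain ⟨c, hca, hc⟩ := h.exists_shrink N
  have hex : ∃ n : ℕ, Real.sin n ∈ Set.Ioo (Real.sin d) c :=
    exists_sin_natCast_mem_Ioo_s15 (Real.neg_one_le_sin _) hc.2.1 hc.1
  obtain ⟨hd, hdc⟩ := Nat.find_spec hex
  have hmin := fun m => Nat.find_min hex (m := m)
  set d' := Nat.find hex
  obtain ⟨a', hlt, hle, hgap⟩ := exists_sin_natCast_gap hdc d'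
  refine ⟨d', a', ?_, ⟨hlt, hle.trans hc.2.1, hgap⟩,
    Set.Ico_subset_Ico hd.le (hle.trans hca), fun X hX m hdm hmd => ?_⟩
  · by_contra hN
    exact absurd (hc.2.2 d' (not_lt.1 hN) hdc) (not_le.2 hd)
  · have hgap' : SinGap m d c := ⟨hc.1, hc.2.1, fun Z hZ hZc => by
      by_contra hZd
      exact hmin Z (hZ.trans_lt hmd) ⟨not_le.1 hZd, hZc⟩⟩
    exact hgap'.bestApp ⟨hd.le.trans hX.1, hX.2.trans_le hle⟩ hdm le_rfl

theorem exists_near_sin_natCast (s : ℕ) {γ : ℝ} (hγ : 0 < γ) :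
    ∃ Y : ℕ, s < Y ∧ |Real.sin Y - Real.sin s| < γ := by
  have h₁ := Real.neg_one_le_sin s
  have h₂ := Real.sin_le_one s
  obtain ⟨Y, hsY, hY₁, hY₂⟩ := exists_gt_sin_natCast_mem_Ioo
    (x := max (-1) (Real.sin s - γ)) (y := min 1 (Real.sin s + γ)) (le_max_left _ _)
    (min_le_left _ _) (max_lt (lt_min (by norm_num) (by linarith))
      (lt_min (by linarith) (by linarith))) s
  refine ⟨Y, hsY, abs_lt.2 ⟨?_, ?_⟩⟩
  · linarith [(le_max_right _ _).trans_lt hY₁]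
  · linarith [hY₂.trans_le (min_le_right _ _)]

theorem exists_sin_gap_separation (s Y d e : ℕ) (hsY : s ≠ Y) :
    ∃ η > 0, ∀ Z₁ Z₂ : ℕ, Z₁ ≤ d → Z₂ ≤ e → ({Z₁, Z₂} : Set ℕ) ≠ {s, Y} →
      2 * η ≤ |(|Real.sin Y - Real.sin s| - |Real.sin Z₂ - Real.sin Z₁|)| := by
  classical
  let T : Finset (ℕ × ℕ) := (Finset.range (d + 1) ×ˢ Finset.range (e + 1)).filter
    fun p => ({p.1, p.2} : Set ℕ) ≠ {s, Y}
  let φ : ℕ × ℕ → ℝ := fun p => |(|Real.sin Y - Real.sin s| - |Real.sin p.2 - Real.sin p.1|)|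
  have hpos : ∀ p ∈ T, 0 < φ p := by
    intro p hp
    refine abs_pos.2 (sub_ne_zero.2 fun heq => (Finset.mem_filter.1 hp).2 ?_)
    rw [Set.pair_comm p.1, Set.pair_comm s]
    exact abs_sin_sub_sin_natCast_inj hsY.symm heq
  obtain ⟨η, hη, hle⟩ : ∃ η > 0, ∀ p ∈ T, η ≤ φ p := by
    rcases T.eq_empty_or_nonempty with hT | hT
    · exact ⟨1, one_pos, by simp [hT]⟩
    · obtain ⟨p, hp, hmin⟩ := T.exists_min_image φ hT
      exact ⟨φ p, hpos p hp, hmin⟩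
  refine ⟨η / 2, half_pos hη, fun Z₁ Z₂ h₁ h₂ hne => ?_⟩
  have := hle (Z₁, Z₂) (Finset.mem_filter.2 ⟨by simp; omega, hne⟩)
  simpa [φ, mul_div_cancel₀] using this

/-- Within any open interval, and for sufficiently large bounds `d` and `e`, the position of
`sin X` can be prescribed so that `Best` decodes exactly `s`. -/
theorem exists_Ioo_best_iff {u v : ℝ} (hu : -1 ≤ u) (hv : v ≤ 1) (huv : u < v) (s : ℕ) :
    ∃ N : ℕ, ∀ d, N ≤ d → ∃ M : ℕ, ∀ e, M ≤ e → ∃ u' v', u ≤ u' ∧ u' < v' ∧ v' ≤ v ∧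
      ∀ X : ℕ, Real.sin X ∈ Set.Ioo u' v' → ∃ Y₁, BestApp X d Y₁ ∧
        ∀ s', Best d e Y₁ X s' ↔ s' = s := by
  obtain ⟨y, huy, hyv⟩ := exists_sin_natCast_mem_Ioo_s15 hu hv huv
  refine ⟨max s y, fun d hd => ?_⟩
  obtain ⟨a, hya, hav, hgap⟩ := exists_sin_natCast_gap hyv d
  obtain ⟨Y, hsY, hYa⟩ := exists_near_sin_natCast s (sub_pos.2 hya)
  refine ⟨Y, fun e he => ?_⟩
  obtain ⟨η, hη, hsep⟩ := exists_sin_gap_separation s Y d e hsY.ne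
  set δ := |Real.sin Y - Real.sin s| with hδ
  have hδ0 : 0 < δ :=
    abs_pos.2 (sub_ne_zero.2 fun h => hsY.ne' (sin_natCast_injective h))
  refine ⟨Real.sin y + max 0 (δ - η), min a (Real.sin y + δ + η), ?_, ?_,
    (min_le_left _ _).trans hav, fun X hX => ⟨y, ?_, fun s' => ?_⟩⟩
  · linarith [le_max_left 0 (δ - η)]
  · rw [← lt_sub_iff_add_lt', max_lt_iff, lt_sub_iff_add_lt, lt_min_iff, lt_sub_iff_add_lt,
      lt_min_iff]
    refine ⟨⟨?_, ?_⟩, ?_, ?_⟩ <;> linarith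
  · have hX₁ := le_max_left 0 (δ - η)
    exact SinGap.bestApp (N := d) (a := a) ⟨hya, hav.trans hv, hgap⟩
      ⟨by linarith [hX.1], hX.2.trans_le (min_le_left _ _)⟩ ((le_max_right _ _).trans hd) le_rfl
  · have hX₁ : |Real.sin X - Real.sin y - δ| < η := by
      have h₁ := le_max_right 0 (δ - η)
      have h₂ := hX.2.trans_le (min_le_right _ _)
      exact abs_lt.2 ⟨by linarith [hX.1], by linarith⟩
    have hlt : ∀ Z₁ Z₂ : ℕ, Z₁ ≤ d → Z₂ ≤ e → ({Z₁, Z₂} : Set ℕ) ≠ {s, Y} →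
        gFn y X s Y < gFn y X Z₁ Z₂ := by
      intro Z₁ Z₂ h₁ h₂ hne
      have hZ := hsep Z₁ Z₂ h₁ h₂ hne
      have htri := abs_sub_abs_le_abs_sub (δ - |Real.sin Z₂ - Real.sin Z₁|)
        (-(Real.sin X - Real.sin y - δ))
      rw [abs_neg] at htri
      have hsum : δ - |Real.sin Z₂ - Real.sin Z₁| - -(Real.sin X - Real.sin y - δ) =
          Real.sin X - Real.sin y - |Real.sin Z₂ - Real.sin Z₁| := by ring
      rw [hsum] at htri
      unfold gFn
      rw [← hδ]
      linarith
    have hsd : s ≤ d := (le_max_left _ _).trans hd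
    constructor
    · rintro ⟨Y', hs'd, hY'e, hs'Y', hbest⟩
      have hset : ({s', Y'} : Set ℕ) = {s, Y} := by
        by_contra hne
        exact lt_asymm (hlt s' Y' hs'd hY'e hne) (hbest s Y hsd he (Ne.symm hne))
      rw [Set.pair_eq_pair_iff] at hset
      omega
    · rintro rfl
      exact ⟨Y, hsd, he, hsY, hlt⟩

/-- The finite set `S` is encoded, using thresholds up to `d`, by all `X₁ = X₃`, `X₂`, `X₄` whose
sines lie in suitable intervals. -/
def Encodes (S : Set (ℕ × ℕ)) (d e : ℕ) (a b u v : ℝ) : Prop :=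
  e < d ∧ SinGap d d a ∧ SinGap d e b ∧ -1 ≤ u ∧ u < v ∧ v ≤ 1 ∧
    ∀ X₁ X₂ X₄ : ℕ, Real.sin X₁ ∈ Set.Ico (Real.sin d) a →
      Real.sin X₂ ∈ Set.Ico (Real.sin e) b → Real.sin X₄ ∈ Set.Ioo u v → ∀ s t : ℕ,
        (s, t) ∈ S ↔ ∃ d₁ d₂ d₃ d₄ e₁ e₂ : ℕ, d₃ ≤ d ∧
          Admissible d₁ d₂ d₃ d₄ e₁ e₂ X₁ X₂ X₁ X₄ s t

theorem exists_encodes_empty : ∃ d e a b u v, Encodes ∅ d e a b u v := by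
  have h₀ : SinGap 0 0 1 := by
    refine ⟨by simp, le_rfl, fun Z hZ _ => ?_⟩
    rw [Nat.le_zero.1 hZ]
  obtain ⟨d, a, hd, hgap, -, hrec⟩ := h₀.exists_next 0
  obtain ⟨b, -, hb⟩ := h₀.exists_shrink d
  refine ⟨d, 0, a, b, -1, 1, hd, hgap, hb, le_rfl, by norm_num, le_rfl,
    fun X₁ X₂ X₄ hX₁ _ _ s t => ?_⟩
  simp only [Set.mem_empty_iff_false, false_iff]
  rintro ⟨d₁, d₂, d₃, d₄, e₁, e₂, hd₃, ⟨h₁₂, h₂₃, -, hd₂, -⟩, -⟩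
  have := hd₂.unique (hrec X₁ hX₁ d₂ (Nat.zero_le _) (by omega))
  omega

theorem Encodes.exists_insert {S : Set (ℕ × ℕ)} {d e : ℕ} {a b u v : ℝ}
    (h : Encodes S d e a b u v) (p : ℕ × ℕ) :
    ∃ d' e' a' b' u' v', Encodes (insert p S) d' e' a' b' u' v' := by
  obtain ⟨s₀, t₀⟩ := p
  obtain ⟨hed, hd, he, hu, huv, hv, hS⟩ := h
  obtain ⟨N₁, hN₁⟩ := exists_Ioo_best_iff hu hv huv s₀
  obtain ⟨D₁, a₁, hD₁, hgD₁, hsub₁, hrec₁⟩ := hd.exists_next (max d N₁)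
  obtain ⟨hdD₁, hND₁⟩ := max_lt_iff.1 hD₁
  obtain ⟨M₁, hM₁⟩ := hN₁ D₁ hND₁.le
  obtain ⟨E₁, b₁, hE₁, hgE₁, hsubE₁, hrecE₁⟩ := he.exists_next (max D₁ M₁)
  obtain ⟨hDE₁, hME₁⟩ := max_lt_iff.1 hE₁
  obtain ⟨u₁, v₁, hu₁, huv₁, hv₁, hs⟩ := hM₁ E₁ hME₁.le
  obtain ⟨N₂, hN₂⟩ := exists_Ioo_best_iff (hu.trans hu₁) (hv₁.trans hv) huv₁ t₀
  obtain ⟨D₂, a₂, hD₂, hgD₂, hsub₂, hrec₂⟩ := hgD₁.exists_next (max E₁ N₂)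
  obtain ⟨hED₂, hND₂⟩ := max_lt_iff.1 hD₂
  obtain ⟨M₂, hM₂⟩ := hN₂ D₂ hND₂.le
  obtain ⟨E₂, b₂, hE₂, hgE₂, hsubE₂, hrecE₂⟩ := hgE₁.exists_next (max D₂ M₂)
  obtain ⟨hDE₂, hME₂⟩ := max_lt_iff.1 hE₂
  obtain ⟨u₂, v₂, hu₂, huv₂, hv₂, ht⟩ := hM₂ E₂ hME₂.le
  obtain ⟨D₃, a₃, hD₃, hgD₃, hsub₃, hrec₃⟩ := hgD₂.exists_next E₂
  obtain ⟨b₃, hb₃, hgb₃⟩ := hgE₂.exists_shrink D₃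
  clear hD₁ hND₁ hE₁ hME₁ hD₂ hND₂ hE₂ hME₂
  refine ⟨D₃, E₂, a₃, b₃, u₂, v₂, hD₃, hgD₃, hgb₃, (hu.trans hu₁).trans hu₂, huv₂,
    (hv₂.trans hv₁).trans hv, fun X₁ X₂ X₄ hX₁ hX₂ hX₄ s t => ?_⟩
  have hX₁D₂ := hsub₃ hX₁
  have hX₁D₁ := hsub₂ hX₁D₂
  have hX₂E₂ : Real.sin X₂ ∈ Set.Ico (Real.sin E₂) b₂ := ⟨hX₂.1, hX₂.2.trans_le hb₃⟩
  have hX₂E₁ := hsubE₂ hX₂E₂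
  have hX₄' := Set.Ioo_subset_Ioo hu₂ hv₂ hX₄
  have hold := hS X₁ X₂ X₄ (hsub₁ hX₁D₁) (hsubE₁ hX₂E₁) (Set.Ioo_subset_Ioo hu₁ hv₁ hX₄') s t
  have rD := hrec₁ X₁ hX₁D₁
  have rD₁ := hrec₂ X₁ hX₁D₂
  have rD₂ := hrec₃ X₁ hX₁
  have rE := hrecE₁ X₂ hX₂E₁
  have rE₁ := hrecE₂ X₂ hX₂E₂
  have rE₂ := fun m h₁ h₂ => hgb₃.bestApp (m := m) hX₂ h₁ h₂
  obtain ⟨y₁, hy₁, hys⟩ := hs X₄ hX₄'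
  obtain ⟨y₃, hy₃, hyt⟩ := ht X₄ hX₄
  rw [Set.mem_insert_iff, hold, Prod.mk.injEq]
  constructor
  · rintro (⟨rfl, rfl⟩ | ⟨d₁, d₂, d₃, d₄, e₁, e₂, hd₃, hadm⟩)
    · exact ⟨D₁, D₂, D₃, D₁, E₁, E₂, le_rfl,
        ⟨by omega, by omega, rD₁ _ le_rfl (by omega), rD₂ _ le_rfl (by omega),
          hgD₃.bestApp hX₁ le_rfl le_rfl, rD₁ (D₂ - 1) (by omega) (by omega),
          rD₂ (D₃ - 1) (by omega) (by omega)⟩,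
        ⟨le_rfl, by omega, rD₁ _ le_rfl (by omega)⟩,
        ⟨by omega, by omega, by omega, by omega, rE₁ _ le_rfl (by omega),
          rE₂ _ le_rfl (by omega)⟩,
        ⟨y₁, hy₁, (hys _).2 rfl⟩, ⟨y₃, hy₃, (hyt _).2 rfl⟩⟩
    · exact ⟨d₁, d₂, d₃, d₄, e₁, e₂, by omega, hadm⟩
  · rintro ⟨d₁, d₂, d₃, d₄, e₁, e₂, hd₃, hadm⟩
    rcases le_or_gt d₃ d with hle | hgt
    · exact Or.inr ⟨d₁, d₂, d₃, d₄, e₁, e₂, hle, hadm⟩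
    left
    obtain ⟨⟨h₁₂, h₂₃, -, hr₂, hr₃, hp₁, hp₂⟩, -, ⟨hde₁, hed₁, hde₂, hed₂, hre₁, hre₂⟩,
      ⟨Y₁, hY₁, hbs⟩, ⟨Y₃, hY₃, hbt⟩⟩ := hadm
    have noE : ∀ m, d ≤ m → m < D₁ → ¬ BestApp X₂ m m := by
      intro m h₁ h₂ hm
      have := hm.unique (rE m (by omega) (by omega))
      omega
    have hd₃D₁ : D₁ ≤ d₃ := by
      by_contra hlt
      have := hr₃.unique (rD d₃ (by omega) (by omega))
      omega
    rcases hd₃D₁.eq_or_lt with rfl | hd₃D₁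
    · have := hp₂.unique (rD _ (by omega) (by omega))
      exact (noE e₂ (by omega) (by omega) hre₂).elim
    have hd₃D₂ : D₂ ≤ d₃ := by
      by_contra hlt
      have := hr₃.unique (rD₁ d₃ (by omega) (by omega))
      omega
    rcases hd₃D₂.eq_or_lt with rfl | hd₃D₂
    · obtain rfl := hp₂.unique (rD₁ _ (by omega) (by omega))
      have := hp₁.unique (rD _ (by omega) (by omega))
      exact (noE e₁ (by omega) (by omega) hre₁).elim
    have hd₃D₃ : d₃ = D₃ := by
      by_contra hlt
      have := hr₃.unique (rD₂ d₃ (by omega) (by omega))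
      omega
    subst hd₃D₃
    obtain rfl := hp₂.unique (rD₂ (d₃ - 1) (by omega) (by omega))
    obtain rfl := hp₁.unique (rD₁ (d₂ - 1) (by omega) (by omega))
    have he₁ : e₁ = E₁ := by
      rcases lt_or_ge e₁ E₁ with hlt | hge
      · have := hre₁.unique (rE e₁ (by omega) hlt)
        omega
      · exact hre₁.unique (rE₁ e₁ hge (by omega))
    have he₂ : e₂ = E₂ := by
      rcases lt_or_ge e₂ E₂ with hlt | hge
      · have := hre₂.unique (rE₁ e₂ (by omega) hlt)
        omega
      · exact hre₂.unique (rE₂ e₂ hge (by omega))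
    subst he₁ he₂
    obtain rfl := hY₁.unique hy₁
    obtain rfl := hY₃.unique hy₃
    exact ⟨(hys s).1 hbs, (hyt t).1 hbt⟩

theorem exists_encodes_of_finite {S : Set (ℕ × ℕ)} (hS : S.Finite) :
    ∃ d e a b u v, Encodes S d e a b u v := by
  induction S, hS using Set.Finite.induction_on with
  | empty => exact exists_encodes_empty
  | insert _ _ ih =>
    obtain ⟨d, e, a, b, u, v, h⟩ := ih
    exact h.exists_insert _

/-- **Theorem 3.16.** For every finite `S ⊆ ℕ²` there are naturals
`X₁, X₂, X₃, X₄` such that for all `s, t`,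
`(s, t) ∈ S ↔ Member X₁ X₂ X₃ X₄ s t`. -/
theorem finite_set_encoded_by_member (S : Set (ℕ × ℕ)) (hS : S.Finite) :
    ∃ X₁ X₂ X₃ X₄ : ℕ, ∀ s t : ℕ, (s, t) ∈ S ↔ Member X₁ X₂ X₃ X₄ s t := by
  obtain ⟨d, e, a, b, u, v, -, hd, he, hu, huv, hv, h⟩ := exists_encodes_of_finite hS
  obtain ⟨X₄, hX₄⟩ := exists_sin_natCast_mem_Ioo_s15 hu hv huv
  refine ⟨d, e, d, X₄, fun s t => ?_⟩
  rw [h d e X₄ ⟨le_rfl, hd.1⟩ ⟨le_rfl, he.1⟩ hX₄ s t]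
  constructor
  · rintro ⟨d₁, d₂, d₃, d₄, e₁, e₂, -, hadm⟩
    exact ⟨d₁, d₂, d₃, d₄, e₁, e₂, hadm⟩
  · rintro ⟨d₁, d₂, d₃, d₄, e₁, e₂, hadm⟩
    refine ⟨d₁, d₂, d₃, d₄, e₁, e₂, ?_, hadm⟩
    by_contra hlt
    have hr : BestApp d d₃ d₃ := hadm.1.2.2.2.2.1
    exact absurd (hr.2.2 d (not_le.1 hlt).le (not_le.1 hlt).ne le_rfl) (not_lt.2 hr.2.1)
end

section
/- Assume Schanuel's conjecture. Let n, m ≥ 0, K > 0 be integers and z ∈ ℚⁿ. Let q₁, …, q_m with qᵢ ∈ ℚ^{n+i}, and define real numbers t₁, …, t_m recursively by tᵢ = sin(qᵢ · (z, 1, t₁, …, t_{i−1})). Let p₀ ∈ ℚ^{n+1}, let p₁, …, p_K ∈ ℚ^{m+n+1} be nonzero vectors such that for all distinct i, j there is a coordinate k with |p_{i,k}| ≠ |p_{j,k}|, and let r₁, …, r_K ∈ ℚ be nonzero. Set Pᵢ := pᵢ · (z, 1, t₁, …, t_m). If p₀ · (z, 1) + Σᵢ₌₁ᴷ rᵢ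 sin Pᵢ = 0, then at least one of the following holds: (i) there is i ∈ {1, …, K} with Pᵢ = 0; (ii) there are distinct i, j ∈ {1, …, K} with |Pᵢ| = |Pⱼ|. -/
/-- The dimension of the `ℚ`-linear span of a finite family of complex numbers. -/
noncomputable def qLinDim {n : ℕ} (α : Fin n → ℂ) : ℕ :=
  Module.finrank ℚ (Submodule.span ℚ (Set.range α))

/-- **Schanuel's conjecture**: for all complex numbers `α₁, …, αₙ`, the
transcendence degree over `ℚ` of `ℚ(α₁, …, αₙ, exp α₁, …, exp αₙ)` is at least
the dimension of the `ℚ`-linear span of `α₁, …, αₙ`; equivalently, among the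
generators `αᵢ, exp αᵢ` there is an algebraically independent subfamily of
that cardinality. -/
def SchanuelConjecture : Prop :=
  ∀ (n : ℕ) (α : Fin n → ℂ),
    ∃ s : Finset (Fin n ⊕ Fin n),
      s.card = qLinDim α ∧
      AlgebraicIndependent ℚ
        (fun i : s => Sum.elim α (fun j => Complex.exp (α j)) (i : Fin n ⊕ Fin n))

/-- The concatenated vector `(z, 1, t₁, …, t_m)` (entries of `z`, then `1`,
then the entries of `t`). -/
noncomputable def sinVec {n : ℕ} (z : Fin n → ℚ) {m : ℕ} (t : Fin m → ℝ) :
    Fin (n + 1 + m) → ℝ :=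
  Fin.append (Fin.append (fun i => (z i : ℝ)) (fun _ : Fin 1 => (1 : ℝ))) t

theorem I_mem_algebraicClosure (k : Type*) [Field k] [Algebra k ℂ] :
    Complex.I ∈ algebraicClosure k ℂ := by
  rw [mem_algebraicClosure_iff]
  exact IsAlgebraic.of_pow (n := 2) two_pos (by
    rw [Complex.I_sq]
    exact (isAlgebraic_one (R := k) (A := ℂ)).neg)

open AlgebraicIndependent in
/-- A finite family over whose adjunction a large enough algebraically independent family is
algebraic is itself algebraically independent. -/
theorem algebraicIndependent_of_isAlgebraic_adjoin {F E ι κ : Type*} [Field F] [Field E]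
    [Algebra F E] [Fintype ι] [Fintype κ] {x : ι → E} {y : κ → E}
    (hy : AlgebraicIndependent F y) (hcard : Fintype.card ι ≤ Fintype.card κ)
    (halg : ∀ k, IsAlgebraic (Algebra.adjoin F (Set.range x)) (y k)) :
    AlgebraicIndependent F x := by
  have hyind : (matroid F E).Indep (Set.range y) := hy.to_subtype_range
  obtain ⟨B, hB⟩ := (matroid F E).exists_isBasis (Set.range x)
  have hsub : Set.range y ⊆ (matroid F E).closure (Set.range x) := by
    rw [matroid_closure_eq]
    rintro _ ⟨k, rfl⟩
    exact halg k
  have h1 : (Set.range y).encard ≤ B.encard := by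
    rw [← hB.eRk_eq_encard, ← Matroid.eRk_closure_eq]
    exact hyind.encard_le_eRk_of_subset hsub
  have h2 : (Set.range y).encard = Fintype.card κ := by
    rw [← Set.image_univ, hy.injective.encard_image]
    simp
  have h3 : (Set.range x).encard ≤ Fintype.card ι := by
    rw [← Set.image_univ]
    exact (Set.encard_image_le _ _).trans (by simp)
  have h4 : (Fintype.card ι : ℕ∞) ≤ Fintype.card κ := by exact_mod_cast hcard
  have hBx : B = Set.range x :=
    ((Set.finite_range x).subset hB.subset).eq_of_subset_of_encard_le hB.subset
      (h3.trans (h4.trans (h2.symm.le.trans h1)))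
  have hinj : Function.Injective x := by
    rw [← Set.injOn_univ]
    refine Set.finite_univ.injOn_of_encard_image_eq (le_antisymm (Set.encard_image_le _ _) ?_)
    rw [Set.image_univ, ← hBx]
    exact le_trans (by simp) (h4.trans (h2.symm.le.trans h1))
  rw [← algebraicIndependent_subtype_range hinj]
  exact hBx ▸ hB.indep

/-- The exponential of a group element as a monomial in the exponentials of a basis. -/
theorem exp_eq_prod_zpow_of_basis {ι : Type*} [Fintype ι] {N : Submodule ℤ ℝ}
    (b : Module.Basis ι ℤ N) (v : N) :
    Complex.exp (Complex.I * ((v : ℝ) : ℂ))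
      = ∏ j, Complex.exp (Complex.I * ((b j : ℝ) : ℂ)) ^ (b.repr v j) := by
  have hv : ∑ j, (b.repr v j : ℝ) * (b j : ℝ) = v := by
    have h := congrArg N.subtype (b.sum_repr v)
    simpa only [map_sum, map_zsmul, map_smul, Submodule.subtype_apply, zsmul_eq_mul,
      smul_eq_mul] using h
  rw [← hv]
  push_cast
  rw [Finset.mul_sum, Complex.exp_sum]
  refine Finset.prod_congr rfl fun j _ => ?_
  rw [← Complex.exp_int_mul]
  ring_nf

/-- If the exponentials `exp (i b)` of a finite basis of a group of real numbers are algebraically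
independent, then the exponentials `exp (i v)` of all elements are linearly independent. -/
theorem linearIndependent_exp_of_basis {F ι : Type*} [Field F] [Algebra F ℂ] [Fintype ι]
    {N : Submodule ℤ ℝ} (b : Module.Basis ι ℤ N)
    (hb : AlgebraicIndependent F fun j => Complex.exp (Complex.I * ((b j : ℝ) : ℂ))) :
    LinearIndependent F fun v : N => Complex.exp (Complex.I * ((v : ℝ) : ℂ)) := by
  set x : ι → ℂ := fun j => Complex.exp (Complex.I * ((b j : ℝ) : ℂ)) with hx
  have hmon : LinearIndependent F fun e : ι →₀ ℕ => ∏ j, x j ^ e j := by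
    have h := (MvPolynomial.basisMonomials ι F).linearIndependent.map'
      (MvPolynomial.aeval x : MvPolynomial ι F →ₐ[F] ℂ).toLinearMap
      (LinearMap.ker_eq_bot.mpr hb)
    have heq : (MvPolynomial.aeval x : MvPolynomial ι F →ₐ[F] ℂ).toLinearMap ∘
        MvPolynomial.basisMonomials ι F = fun e : ι →₀ ℕ => ∏ j, x j ^ e j := by
      ext e
      simp [MvPolynomial.aeval_monomial, Finsupp.prod_fintype]
    exact heq ▸ h
  rw [linearIndependent_iff']
  intro s c hc
  let M : ℕ := ∑ v ∈ s, ∑ j, (b.repr v j).natAbs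
  have hM (v : N) (hv : v ∈ s) (j : ι) : 0 ≤ b.repr v j + M := by
    have h1 : (b.repr v j).natAbs ≤ M :=
      (Finset.single_le_sum (f := fun j => (b.repr v j).natAbs) (fun _ _ => Nat.zero_le _)
        (Finset.mem_univ j)).trans
        (Finset.single_le_sum (f := fun v => ∑ j, (b.repr v j).natAbs)
          (fun _ _ => Nat.zero_le _) hv)
    lia
  let e (v : s) : ι →₀ ℕ := Finsupp.equivFunOnFinite.symm fun j => (b.repr v.1 j + M).toNat
  have he : Function.Injective e := by
    intro v w h
    refine Subtype.ext (b.repr.injective (Finsupp.ext fun j => ?_))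
    have h' := DFunLike.congr_fun h j
    have hv := hM v v.2 j
    have hw := hM w w.2 j
    simp only [e, Finsupp.equivFunOnFinite_symm_apply_apply] at h'
    lia
  have hshift (v : s) : Complex.exp (Complex.I * ((v : ℝ) : ℂ)) * ∏ j, x j ^ M
      = ∏ j, x j ^ e v j := by
    rw [exp_eq_prod_zpow_of_basis b, ← Finset.prod_mul_distrib]
    refine Finset.prod_congr rfl fun j _ => ?_
    have h : ((e v j : ℕ) : ℤ) = b.repr v.1 j + M := by
      simp only [e, Finsupp.equivFunOnFinite_symm_apply_apply]
      exact Int.toNat_of_nonneg (hM v v.2 j)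
    rw [← zpow_natCast (x j) (e v j), h, zpow_add₀ (Complex.exp_ne_zero _), zpow_natCast]
  have hzero := Fintype.linearIndependent_iff.mp (hmon.comp e he) (fun v => c v) (by
    calc ∑ v : s, c v • ∏ j, x j ^ e v j
        = (∑ v : s, c v • Complex.exp (Complex.I * ((v : ℝ) : ℂ))) * ∏ j, x j ^ M := by
          rw [Finset.sum_mul]
          exact Finset.sum_congr rfl fun v _ => by rw [← hshift, smul_mul_assoc]
      _ = 0 := by
          rw [Finset.sum_coe_sort s fun v => c v • Complex.exp (Complex.I * ((v : ℝ) : ℂ)), hc,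
            zero_mul])
  exact fun v hv => hzero ⟨v, hv⟩

/-- Under Schanuel's conjecture, let `N` be a finitely generated group of real numbers with a
basis `b`. If every element of `N` is algebraic over the field generated by the `exp (i b)`, then
the exponentials `exp (i v)` with `v ∈ N` are linearly independent over the algebraic numbers. -/
theorem SchanuelConjecture.linearIndependent_exp (schanuel : SchanuelConjecture) {d : ℕ}
    {N : Submodule ℤ ℝ} (b : Module.Basis (Fin d) ℤ N)
    (halg : ∀ v : N, ((v : ℝ) : ℂ) ∈ algebraicClosure (IntermediateField.adjoin ℚ
      (Set.range fun j => Complex.exp (Complex.I * ((b j : ℝ) : ℂ)))) ℂ) :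
    LinearIndependent (algebraicClosure ℚ ℂ)
      fun v : N => Complex.exp (Complex.I * ((v : ℝ) : ℂ)) := by
  set x : Fin d → ℂ := fun j => Complex.exp (Complex.I * ((b j : ℝ) : ℂ)) with hx
  set L := algebraicClosure (IntermediateField.adjoin ℚ (Set.range x)) ℂ
  let α : Fin d → ℂ := fun j => Complex.I * ((b j : ℝ) : ℂ)
  have hαL (j : Fin d) : α j ∈ L := mul_mem (I_mem_algebraicClosure _) (halg (b j))
  have hxL (j : Fin d) : x j ∈ L :=
    L.algebraMap_mem ⟨x j, IntermediateField.subset_adjoin ℚ _ ⟨j, rfl⟩⟩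
  have hlin : LinearIndependent ℚ α := by
    rw [← LinearIndependent.iff_fractionRing ℤ ℚ]
    have h1 : LinearIndependent ℤ fun j => (b j : ℝ) :=
      b.linearIndependent.map' N.subtype N.ker_subtype
    refine h1.map_injOn
      ((LinearMap.mulLeft ℤ Complex.I).comp (Complex.ofRealAm.toLinearMap.restrictScalars ℤ)) ?_
    intro u _ v _ h
    simpa using h
  obtain ⟨s, hs, hind⟩ := schanuel d α
  rw [qLinDim, finrank_span_eq_card hlin, Fintype.card_fin] at hs
  refine linearIndependent_exp_of_basis b (AlgebraicIndependent.algebraicClosure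
    (algebraicIndependent_of_isAlgebraic_adjoin hind (by simp [hs]) ?_))
  rintro ⟨k | k, hk⟩
  · exact IntermediateField.isAlgebraic_adjoin_iff.mp (mem_algebraicClosure_iff.mp (hαL k))
  · exact IntermediateField.isAlgebraic_adjoin_iff.mp (mem_algebraicClosure_iff.mp (hxL k))

/-- A subfield of `ℂ` containing `i` and the exponentials of a basis of `N` contains the sines of
all elements of `N`. -/
theorem sin_mem_of_basis {ι S : Type*} [Fintype ι] [SetLike S ℂ] [SubfieldClass S ℂ] {L : S}
    {N : Submodule ℤ ℝ} (b : Module.Basis ι ℤ N) (hI : Complex.I ∈ L)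
    (hb : ∀ j, Complex.exp (Complex.I * ((b j : ℝ) : ℂ)) ∈ L) {v : ℝ} (hv : v ∈ N) :
    ((Real.sin v : ℝ) : ℂ) ∈ L := by
  have hexp {u : ℝ} (hu : u ∈ N) : Complex.exp (Complex.I * (u : ℂ)) ∈ L := by
    rw [exp_eq_prod_zpow_of_basis b ⟨u, hu⟩]
    exact prod_mem fun j _ => zpow_mem (hb j) _
  have h1 := hexp hv
  have h2 := hexp (neg_mem hv)
  rw [Complex.ofReal_sin, Complex.sin]
  refine div_mem (mul_mem (sub_mem ?_ ?_) hI) (ofNat_mem _ 2)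
  · convert h2 using 2
    push_cast
    ring
  · convert h1 using 2
    ring

/-- If the `exp (i v)` with `v ∈ N` are linearly independent over the algebraic numbers, a rational
linear combination of sines of nonzero elements of `N` with distinct absolute values is rational
only if all coefficients vanish. -/
theorem sin_coeff_eq_zero {κ : Type*} [Fintype κ] {N : Submodule ℤ ℝ}
    (hN : LinearIndependent (algebraicClosure ℚ ℂ)
      fun v : N => Complex.exp (Complex.I * ((v : ℝ) : ℂ)))
    {P : κ → ℝ} (hPN : ∀ i, P i ∈ N) (h0 : ∀ i, P i ≠ 0)
    (hne : ∀ i j, i ≠ j → |P i| ≠ |P j|) (c : ℚ) (r : κ → ℚ)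
    (h : (c : ℝ) + ∑ i, (r i : ℝ) * Real.sin (P i) = 0) (i : κ) : r i = 0 := by
  let Q := algebraicClosure ℚ ℂ
  let v : Option (κ ⊕ κ) → N
    | none => 0
    | some (.inl i) => ⟨P i, hPN i⟩
    | some (.inr i) => ⟨-P i, neg_mem (hPN i)⟩
  have hinj : ∀ i j, P i = P j → i = j := fun i j hij => by
    by_contra hc
    exact hne i j hc (by rw [hij])
  have hinj' : ∀ i j, P i ≠ -P j := fun i j hij => by
    have : i = j := by
      by_contra hc
      exact hne i j hc (by rw [hij, abs_neg])
    subst this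
    exact h0 i (by linarith)
  have hv : Function.Injective v := by
    rintro (_ | i | i) (_ | j | j) hij <;>
      simp only [v, Subtype.ext_iff, ZeroMemClass.coe_zero] at hij
    · rfl
    · exact absurd hij.symm (h0 j)
    · exact absurd (neg_eq_zero.mp hij.symm) (h0 j)
    · exact absurd hij (h0 i)
    · rw [hinj i j hij]
    · exact absurd hij (hinj' i j)
    · exact absurd (neg_eq_zero.mp hij) (h0 i)
    · exact absurd hij.symm (hinj' j i)
    · rw [hinj i j (neg_injective hij)]
  let I' : Q := ⟨Complex.I, I_mem_algebraicClosure ℚ⟩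
  let a : Option (κ ⊕ κ) → Q
    | none => 2 * I' * c
    | some (.inl i) => r i
    | some (.inr i) => -r i
  have hI' : ((I' : Q) : ℂ) = Complex.I := rfl
  have ha := Fintype.linearIndependent_iff.mp (hN.comp v hv) a (by
    have hC : (c : ℂ) + ∑ i, (r i : ℂ) * Complex.sin (P i) = 0 := by
      exact_mod_cast congrArg Complex.ofReal h
    have hsum : ∑ k, a k • ((fun v : N => Complex.exp (Complex.I * ((v : ℝ) : ℂ))) ∘ v) k
        = 2 * Complex.I * ((c : ℂ) + ∑ i, (r i : ℂ) * Complex.sin (P i)) := by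
      simp only [Fintype.sum_option, Fintype.sum_sum_type, Function.comp, a, v,
        IntermediateField.smul_def, smul_eq_mul]
      rw [← Finset.sum_add_distrib, mul_add, Finset.mul_sum]
      push_cast
      congr 1
      · simp only [hI', mul_zero, Complex.exp_zero, mul_one]
        rfl
      · refine Finset.sum_congr rfl fun i _ => ?_
        rw [Complex.sin]
        have e1 : -(P i : ℂ) * Complex.I = Complex.I * -(P i : ℂ) := by ring
        have e2 : (P i : ℂ) * Complex.I = Complex.I * (P i : ℂ) := by ring
        rw [e1, e2]
        linear_combination (-(r i : ℂ) * (Complex.exp (Complex.I * -(P i : ℂ))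
          - Complex.exp (Complex.I * (P i : ℂ)))) * Complex.I_sq
    rw [hsum, hC, mul_zero])
  have := ha (some (.inl i))
  simpa [a] using this

/-- Rational linear combinations of `(z, 1, t)` lie in every subfield containing `t`. -/
theorem sum_mul_sinVec_mem {S : Type*} [SetLike S ℂ] [SubfieldClass S ℂ] {L : S} {n m : ℕ}
    (z : Fin n → ℚ) (t : Fin m → ℝ) (ht : ∀ i, (t i : ℂ) ∈ L) (a : Fin (n + 1 + m) → ℚ) :
    ((∑ j, (a j : ℝ) * sinVec z t j : ℝ) : ℂ) ∈ L := by
  push_cast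
  refine sum_mem fun j _ => mul_mem (SubfieldClass.ratCast_mem _ _) ?_
  induction j using Fin.addCases with
  | left j =>
    induction j using Fin.addCases with
    | left j => simp [sinVec]
    | right j => simp [sinVec]
  | right j => simpa [sinVec] using ht j

/-- **Lemma 4.5** (nested Lindemann–Weierstrass under Schanuel).  With
`tᵢ = sin (qᵢ · (z, 1, t₁, …, t_{i-1}))` and `Pᵢ = pᵢ · (z, 1, t₁, …, t_m)`,
if `p₀ · (z, 1) + ∑ᵢ rᵢ sin Pᵢ = 0` then some `Pᵢ = 0` or two distinct `Pᵢ, Pⱼ`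
have equal absolute value. -/
theorem nested_sine_lindemann_weierstrass
    (schanuel : SchanuelConjecture)
    (n m K : ℕ) (hK : 0 < K) (z : Fin n → ℚ)
    (q : (i : Fin m) → Fin (n + 1 + i.1) → ℚ)
    (t : Fin m → ℝ)
    (ht : ∀ i : Fin m,
      t i = Real.sin (∑ j, (q i j : ℝ) *
        sinVec z (fun l : Fin i.1 => t ⟨l.1, l.2.trans i.2⟩) j))
    (p₀ : Fin (n + 1) → ℚ)
    (p : Fin K → Fin (n + 1 + m) → ℚ)
    (hp : ∀ i, p i ≠ 0)
    (hpdist : ∀ i j : Fin K, i ≠ j → ∃ k, |p i k| ≠ |p j k|)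
    (r : Fin K → ℚ) (hr : ∀ i, r i ≠ 0)
    (P : Fin K → ℝ)
    (hP : ∀ i, P i = ∑ j, (p i j : ℝ) * sinVec z t j)
    (heq : (∑ j, (p₀ j : ℝ) * sinVec z (Fin.elim0 : Fin 0 → ℝ) j)
        + ∑ i, (r i : ℝ) * Real.sin (P i) = 0) :
    (∃ i, P i = 0) ∨ ∃ i j : Fin K, i ≠ j ∧ |P i| = |P j| := by
  by_contra! hcon
  obtain ⟨h0, hne⟩ := hcon
  let A (i : Fin m) : ℝ :=
    ∑ j, (q i j : ℝ) * sinVec z (fun l : Fin i.1 => t ⟨l.1, l.2.trans i.2⟩) j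
  let g : Fin m ⊕ Fin K → ℝ := Sum.elim A P
  let N : Submodule ℤ ℝ := Submodule.span ℤ (Set.range g)
  have hAN (i : Fin m) : A i ∈ N := Submodule.subset_span ⟨.inl i, rfl⟩
  have hPN (i : Fin K) : P i ∈ N := Submodule.subset_span ⟨.inr i, rfl⟩
  have : Module.Finite ℤ N := Module.Finite.span_of_finite ℤ (Set.finite_range g)
  let b := Module.finBasis ℤ N
  let L := algebraicClosure (IntermediateField.adjoin ℚ
    (Set.range fun j => Complex.exp (Complex.I * ((b j : ℝ) : ℂ)))) ℂ
  have htL (i : Fin m) : (t i : ℂ) ∈ L := by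
    rw [ht i]
    exact sin_mem_of_basis b (I_mem_algebraicClosure _)
      (fun j => L.algebraMap_mem ⟨_, IntermediateField.subset_adjoin ℚ _ ⟨j, rfl⟩⟩) (hAN i)
  have hNL (v : N) : ((v : ℝ) : ℂ) ∈ L := by
    obtain ⟨v, hv⟩ := v
    induction hv using Submodule.span_induction with
    | mem x hx =>
      obtain ⟨i | i, rfl⟩ := hx
      · exact sum_mul_sinVec_mem z _ (fun l => htL _) (q i)
      · change (P i : ℂ) ∈ L
        rw [hP i]
        exact sum_mul_sinVec_mem z t htL (p i)
    | zero => simp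
    | add x y _ _ hx hy => simpa using add_mem hx hy
    | smul k x _ hx => simpa using mul_mem (intCast_mem L k) hx
  have hc : ∑ j, (p₀ j : ℝ) * sinVec z (Fin.elim0 : Fin 0 → ℝ) j
      = ((∑ j : Fin n, p₀ j.castSucc * z j + p₀ (Fin.last n) : ℚ) : ℝ) := by
    rw [Fin.sum_univ_castSucc]
    push_cast
    congr 1
    · refine Finset.sum_congr rfl fun j _ => ?_
      exact congrArg _ ((Fin.append_left _ _ (Fin.castSucc j)).trans (Fin.append_left _ _ j))
    · have h : sinVec z (Fin.elim0 : Fin 0 → ℝ) (Fin.last n) = 1 :=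
        (Fin.append_left _ _ (Fin.last n)).trans (Fin.append_right _ _ (0 : Fin 1))
      exact (congrArg _ h).trans (mul_one _)
  rw [hc] at heq
  exact hr ⟨0, hK⟩ (sin_coeff_eq_zero (schanuel.linearIndependent_exp b hNL) hPN h0 hne _ r heq _)
end

section
/- Assume Schanuel's conjecture. Define sets Sₐ ⊆ ℝ recursively by S₀ = ℚ (viewed as a subset of ℝ) and S_{d+1} = { sin(β + γ) : β is a nonzero element of the ℚ-linear span of S_d, and γ is an element of the ℚ-linear span of ⋃_{j<d+1... j≤d−1? precisely ⋃_{j<d} S_j } — that is, S_{d+1} = { sin α : α = β + γ with β ∈ span_ℚ(S_d), β ≠ 0, γ ∈ span_ℚ(⋃_{j<d} S_j) }. Then for every d > 0, the intersection of the ℚ-linear span of S_d with the ℚ-linear span of ⋃_{j<d} S_j equals {0}. -/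
/-- The sets `S_d ⊆ ℝ`: `S 0 = ℚ`, and
`S (d+1) = { sin (β + γ) : β ∈ span_ℚ (S d), β ≠ 0, γ ∈ span_ℚ (⋃_{j<d} S j) }`. -/
noncomputable def sineDepthSet : ℕ → Set ℝ
  | 0 => Set.range ((↑) : ℚ → ℝ)
  | (d + 1) =>
      { x : ℝ | ∃ β γ : ℝ, β ∈ Submodule.span ℚ (sineDepthSet d) ∧ β ≠ 0 ∧
          γ ∈ Submodule.span ℚ (⋃ j : Fin d, sineDepthSet j.1) ∧
          x = Real.sin (β + γ) }
  decreasing_by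
  · exact Nat.lt_succ_self d
  · exact Nat.lt_succ_of_lt j.2

/-- A finite family over whose generated algebra an at least as large algebraically independent
family is algebraic, is itself algebraically independent. -/
theorem AlgebraicIndependent.of_card_le_of_isAlgebraic {K A ι κ : Type*} [Field K] [Field A]
    [Algebra K A] [Fintype ι] [Fintype κ] {e : κ → A} {y : ι → A}
    (hy : AlgebraicIndependent K y) (hcard : Fintype.card κ ≤ Fintype.card ι)
    (h : ∀ i, IsAlgebraic (Algebra.adjoin K (Set.range e)) (y i)) :
    AlgebraicIndependent K e := by
  set M := AlgebraicIndependent.matroid K A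
  have hI : M.Indep (Set.range y) :=
    AlgebraicIndependent.matroid_indep_iff.2 hy.to_subtype_range
  have hcl : Set.range y ⊆ M.closure (Set.range e) := by
    rw [AlgebraicIndependent.matroid_closure_eq]
    rintro _ ⟨i, rfl⟩
    exact h i
  have hyc : (Set.range y).encard = Fintype.card ι := by
    rw [← Set.image_univ, hy.injective.encard_image, Set.encard_univ, ENat.card_eq_coe_fintype_card]
  have h1 : (Fintype.card ι : ℕ∞) ≤ M.eRk (Set.range e) := by
    rw [← hyc, ← M.eRk_closure_eq]
    exact hI.encard_le_eRk_of_subset hcl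
  have h2 : (Set.range e).encard ≤ Fintype.card κ := by
    rw [← Set.image_univ, ← ENat.card_eq_coe_fintype_card, ← Set.encard_univ]
    exact Set.encard_image_le _ _
  have h3 := M.eRk_le_encard (Set.range e)
  have hcard' : (Fintype.card κ : ℕ∞) ≤ Fintype.card ι := by exact_mod_cast hcard
  have h4 : (Set.range e).encard = Fintype.card κ :=
    le_antisymm h2 (hcard'.trans (h1.trans h3))
  have hinj : Function.Injective e := by
    rw [← Set.injOn_univ]
    refine (Set.toFinite _).injOn_of_encard_image_eq ?_
    rw [Set.image_univ, h4, Set.encard_univ, ENat.card_eq_coe_fintype_card]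
  have hind : M.Indep (Set.range e) := by
    rw [Matroid.indep_iff_eRk_eq_encard_of_finite (Set.finite_range e)]
    exact le_antisymm h3 (h4 ▸ hcard'.trans h1)
  exact (algebraicIndependent_subtype_range hinj).1 (AlgebraicIndependent.matroid_indep_iff.1 hind)

/-- The real numbers `w` for which `exp (i w)` is algebraic over a subalgebra of `ℂ` form a
`ℚ`-subspace of `ℝ`. -/
def algebraicExpSubmodule (A : Subalgebra ℚ ℂ) : Submodule ℚ ℝ where
  carrier := {w | IsAlgebraic A (Complex.exp (Complex.I * w))}
  zero_mem' := by simpa using isAlgebraic_one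
  add_mem' {a b} ha hb := by
    simp only [Set.mem_ofPred_eq, Complex.ofReal_add, mul_add, Complex.exp_add] at *
    exact ha.mul hb
  smul_mem' q w hw := by
    refine IsAlgebraic.of_pow q.den_pos ?_
    have key : Complex.exp (Complex.I * ((q • w : ℝ) : ℂ)) ^ q.den
        = Complex.exp (Complex.I * w) ^ q.num := by
      rw [← Complex.exp_nat_mul, ← Complex.exp_int_mul, Rat.smul_def]
      congr 1
      have : ((q.den : ℚ) : ℂ) * (q : ℂ) = ((q.num : ℚ) : ℂ) := by
        exact_mod_cast Rat.den_mul_eq_num q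
      push_cast at this ⊢
      linear_combination Complex.I * w * this
    rw [key]
    obtain ⟨n, hn | hn⟩ := q.num.eq_nat_or_neg
    · rw [hn, zpow_natCast]
      exact hw.pow n
    · rw [hn, zpow_neg, zpow_natCast]
      exact (hw.pow n).inv

theorem isAlgebraic_I (A : Subalgebra ℚ ℂ) : IsAlgebraic A Complex.I :=
  IsAlgebraic.of_pow two_pos <| by
    rw [Complex.I_sq]
    exact isAlgebraic_one.neg

theorem isAlgebraic_subalgebra_ratCast (A : Subalgebra ℚ ℂ) (q : ℚ) : IsAlgebraic A (q : ℂ) := by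
  simpa using isAlgebraic_algebraMap (A := ℂ) (algebraMap ℚ A q)

theorem isAlgebraic_sin {A : Subalgebra ℚ ℂ} {a : ℝ} (ha : a ∈ algebraicExpSubmodule A) :
    IsAlgebraic A ((Real.sin a : ℝ) : ℂ) := by
  have ha' : IsAlgebraic A (Complex.exp (Complex.I * (-a : ℝ))) :=
    (algebraicExpSubmodule A).neg_mem ha
  have h2 : IsAlgebraic A (2⁻¹ : ℂ) := by
    simpa using isAlgebraic_subalgebra_ratCast A 2⁻¹
  have : ((Real.sin a : ℝ) : ℂ) =
      (Complex.exp (Complex.I * (-a : ℝ)) - Complex.exp (Complex.I * a)) * Complex.I * 2⁻¹ := by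
    rw [Complex.ofReal_sin, Complex.sin]
    push_cast
    ring_nf
  rw [this]
  exact ((ha'.sub ha).mul (isAlgebraic_I A)).mul h2

/-- The finite-dimensional `ℚ`-subspaces `F` of `ℝ` spanned by elements lying in
`span_ℚ ({1} ∪ sin F)`. -/
def IsSineGenerated (F : Submodule ℚ ℝ) : Prop :=
  F.FG ∧ F ≤ Submodule.span ℚ (insert 1 (Real.sin '' F))

theorem IsSineGenerated.sup {F G : Submodule ℚ ℝ} (hF : IsSineGenerated F)
    (hG : IsSineGenerated G) : IsSineGenerated (F ⊔ G) := by
  refine ⟨hF.1.sup hG.1, sup_le (hF.2.trans ?_) (hG.2.trans ?_)⟩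
  · gcongr
    exact le_sup_left
  · gcongr
    exact le_sup_right

theorem IsSineGenerated.bot : IsSineGenerated ⊥ := ⟨Submodule.fg_bot, bot_le⟩

theorem IsSineGenerated.isAlgebraic {F : Submodule ℚ ℝ} (hF : IsSineGenerated F)
    {A : Subalgebra ℚ ℂ} (hA : F ≤ algebraicExpSubmodule A) {w : ℝ} (hw : w ∈ F) :
    IsAlgebraic A (w : ℂ) := by
  have hw' := hF.2 hw
  clear hw
  induction hw' using Submodule.span_induction with
  | mem x hx =>
    rcases hx with rfl | ⟨a, ha, rfl⟩
    · simpa using isAlgebraic_one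
    · exact isAlgebraic_sin (hA ha)
  | zero => simpa using isAlgebraic_zero
  | add x y _ _ hx hy => simpa using hx.add hy
  | smul q x _ hx =>
    have hq : IsAlgebraic A (q : ℂ) := isAlgebraic_subalgebra_ratCast A q
    simpa [Rat.smul_def] using hq.mul hx

theorem SchanuelConjecture.algebraicIndependent_exp (schanuel : SchanuelConjecture)
    {F : Submodule ℚ ℝ} (hF : IsSineGenerated F) {n : ℕ} (c : Module.Basis (Fin n) ℚ F) :
    AlgebraicIndependent ℚ (fun k => Complex.exp (Complex.I * ((c k : ℝ) : ℂ))) := by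
  obtain ⟨s, hs, hind⟩ := schanuel n (fun k => Complex.I * ((c k : ℝ) : ℂ))
  have hdim : qLinDim (fun k => Complex.I * ((c k : ℝ) : ℂ)) = n := by
    have hli : LinearIndependent ℚ (fun k => Complex.I * ((c k : ℝ) : ℂ)) := by
      let f : F →ₗ[ℚ] ℂ := (LinearMap.mulLeft ℚ Complex.I) ∘ₗ
        (Complex.ofRealAm.toLinearMap.restrictScalars ℚ) ∘ₗ F.subtype
      refine c.linearIndependent.map' f (LinearMap.ker_eq_bot.2 fun x y hxy => ?_)
      have : Complex.I * ((x : ℝ) : ℂ) = Complex.I * ((y : ℝ) : ℂ) := hxy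
      simpa using this
    rw [qLinDim, finrank_span_eq_card hli, Fintype.card_fin]
  refine AlgebraicIndependent.of_card_le_of_isAlgebraic hind (by simp [hs, hdim]) ?_
  set A := Algebra.adjoin ℚ (Set.range fun k => Complex.exp (Complex.I * ((c k : ℝ) : ℂ)))
  have hexp (k : Fin n) : IsAlgebraic A (Complex.exp (Complex.I * ((c k : ℝ) : ℂ))) :=
    isAlgebraic_algebraMap (⟨_, Algebra.subset_adjoin ⟨k, rfl⟩⟩ : A)
  have hA : F ≤ algebraicExpSubmodule A := by
    intro w hw
    have : (⟨w, hw⟩ : F) ∈ (algebraicExpSubmodule A).comap F.subtype := by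
      rw [← c.sum_repr ⟨w, hw⟩]
      exact Submodule.sum_mem _ fun k _ => Submodule.smul_mem _ _ (hexp k)
    exact this
  rintro ⟨k | k, hk⟩
  · exact (isAlgebraic_I A).mul (hF.isAlgebraic hA (c k).2)
  · exact hexp k

theorem exists_natCast_eq_mul_add (s : Finset ℚ) :
    ∃ N M : ℕ, 0 < N ∧ ∀ q ∈ s, ∃ m : ℕ, (m : ℚ) = N * q + M := by
  induction s using Finset.induction_on with
  | empty => exact ⟨1, 0, one_pos, by simp⟩
  | insert q s _ ih =>
    obtain ⟨N, M, hN, h⟩ := ih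
    refine ⟨N * q.den, M * q.den + (N * q.num).natAbs, by positivity, fun r hr => ?_⟩
    rcases Finset.mem_insert.1 hr with rfl | hr
    · have hnn : 0 ≤ (N : ℤ) * r.num + ((N * r.num).natAbs : ℤ) := by
        rw [Int.natCast_natAbs]
        linarith [neg_abs_le ((N : ℤ) * r.num)]
      obtain ⟨m, hm⟩ := Int.eq_ofNat_of_zero_le hnn
      refine ⟨m + M * r.den, ?_⟩
      have hm' : (N : ℚ) * r.num + ((N * r.num).natAbs : ℚ) = m := by
        simpa using congrArg (Int.cast (R := ℚ)) hm
      have hd : (r.den : ℚ) * r = r.num := Rat.den_mul_eq_num r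
      push_cast
      linear_combination -hm' - (N : ℚ) * hd
    · obtain ⟨m, hm⟩ := h r hr
      refine ⟨m * q.den + (N * q.num).natAbs, ?_⟩
      push_cast
      linear_combination (q.den : ℚ) * hm

/-- Up to a common translation, finitely many vectors of a finite-dimensional `ℚ`-vector space
have natural number coordinates in some basis. -/
theorem exists_basis_forall_add_eq_sum_nsmul {V : Type*} [AddCommGroup V] [Module ℚ V]
    [Module.Finite ℚ V] (T : Finset V) :
    ∃ (n : ℕ) (c : Module.Basis (Fin n) ℚ V) (v : V),
      ∀ w ∈ T, ∃ m : Fin n →₀ ℕ, w + v = ∑ k, m k • c k := by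
  let b := Module.finBasis ℚ V
  obtain ⟨N, M, hN, h⟩ := exists_natCast_eq_mul_add
    ((T ×ˢ Finset.univ).image fun p => b.repr p.1 p.2)
  have hN' : (N : ℚ) ≠ 0 := by positivity
  let u : ℚˣ := (Units.mk0 (N : ℚ) hN')⁻¹
  refine ⟨_, b.unitsSMul fun _ => u, ∑ k, M • b.unitsSMul (fun _ => u) k, fun w hw => ?_⟩
  choose m hm using fun k => h (b.repr w k)
    (Finset.mem_image.2 ⟨(w, k), by simpa using hw, rfl⟩)
  refine ⟨Finsupp.equivFunOnFinite.symm m, ?_⟩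
  conv_lhs => rw [← b.sum_repr w]
  rw [← Finset.sum_add_distrib]
  refine Finset.sum_congr rfl fun k _ => ?_
  rw [Module.Basis.unitsSMul_apply, Finsupp.coe_equivFunOnFinite_symm, ← Nat.cast_smul_eq_nsmul ℚ,
    ← Nat.cast_smul_eq_nsmul ℚ, hm k, add_smul, Units.smul_def]
  congr 1
  rw [smul_smul]
  congr 1
  simp only [u, Units.val_inv_eq_inv_val, Units.val_mk0]
  field_simp

/-- The union of all `ℚ`-subspaces of `ℝ` satisfying `IsSineGenerated`. -/
def sineHull : Submodule ℚ ℝ where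
  carrier := {w | ∃ F, IsSineGenerated F ∧ w ∈ F}
  zero_mem' := ⟨⊥, .bot, zero_mem _⟩
  add_mem' := by
    rintro a b ⟨F, hF, ha⟩ ⟨G, hG, hb⟩
    exact ⟨F ⊔ G, hF.sup hG,
      add_mem (Submodule.mem_sup_left ha) (Submodule.mem_sup_right hb)⟩
  smul_mem' := by
    rintro q a ⟨F, hF, ha⟩
    exact ⟨F, hF, F.smul_mem q ha⟩

theorem one_mem_sineHull : (1 : ℝ) ∈ sineHull :=
  ⟨ℚ ∙ 1, ⟨Submodule.fg_span_singleton _, Submodule.span_mono (by simp)⟩,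
    Submodule.mem_span_singleton_self _⟩

theorem sin_mem_sineHull {a : ℝ} (ha : a ∈ sineHull) : Real.sin a ∈ sineHull := by
  obtain ⟨F, hF, haF⟩ := ha
  refine ⟨F ⊔ ℚ ∙ Real.sin a, ⟨hF.1.sup (Submodule.fg_span_singleton _), sup_le ?_ ?_⟩,
    Submodule.mem_sup_right (Submodule.mem_span_singleton_self _)⟩
  · refine hF.2.trans ?_
    gcongr
    exact le_sup_left
  · rw [Submodule.span_singleton_le_iff_mem]
    exact Submodule.subset_span (Or.inr ⟨a, Submodule.mem_sup_left haF, rfl⟩)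

theorem exists_isSineGenerated_superset (T : Finset sineHull) :
    ∃ F, IsSineGenerated F ∧ ∀ w ∈ T, (w : ℝ) ∈ F := by
  induction T using Finset.induction_on with
  | empty => exact ⟨⊥, .bot, by simp⟩
  | insert w T _ ih =>
    obtain ⟨F, hF, hT⟩ := ih
    obtain ⟨G, hG, hw⟩ := w.2
    refine ⟨F ⊔ G, hF.sup hG, fun x hx => ?_⟩
    rcases Finset.mem_insert.1 hx with rfl | hx
    · exact Submodule.mem_sup_right hw
    · exact Submodule.mem_sup_left (hT x hx)

/-- Under Schanuel's conjecture, the numbers `exp (i w)` for `w` in the sine hull are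
`ℚ`-linearly independent. -/
theorem SchanuelConjecture.linearIndependent_exp_s17 (schanuel : SchanuelConjecture) :
    LinearIndependent ℚ
      (fun w : sineHull => Complex.exp (Complex.I * ((w : ℝ) : ℂ))) := by
  rw [linearIndependent_iff']
  intro T g hg
  obtain ⟨F, hF, hT⟩ := exists_isSineGenerated_superset T
  have : Module.Finite ℚ F := Module.Finite.iff_fg.2 hF.1
  obtain ⟨n, c, v, h⟩ := exists_basis_forall_add_eq_sum_nsmul
    (T.attach.image fun w : T => (⟨w.1, hT w.1 w.2⟩ : F))
  have h' (w : T) : ∃ m : Fin n →₀ ℕ, (w : ℝ) + v = ∑ k, m k • (c k : ℝ) := by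
    obtain ⟨m, hm⟩ := h ⟨w, hT w w.2⟩ (Finset.mem_image.2 ⟨w, Finset.mem_attach _ _, rfl⟩)
    exact ⟨m, by simpa using congrArg F.subtype hm⟩
  choose m hm using h'
  have hminj : Function.Injective m := fun a b hab => by
    have := hm a
    rw [hab, ← hm b] at this
    exact Subtype.ext (Subtype.ext (add_right_cancel this))
  have hind := schanuel.algebraicIndependent_exp hF c
  rw [algebraicIndependent_iff] at hind
  have hP := hind (∑ w : T, MvPolynomial.monomial (m w) (g w)) <| by
    have hterm (w : T) : MvPolynomial.aeval
        (fun k => Complex.exp (Complex.I * ((c k : ℝ) : ℂ))) (MvPolynomial.monomial (m w) (g w))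
        = (g w • Complex.exp (Complex.I * ((w : ℝ) : ℂ))) *
          Complex.exp (Complex.I * ((v : ℝ) : ℂ)) := by
      rw [MvPolynomial.aeval_monomial, Finsupp.prod_fintype _ _ (by simp)]
      simp_rw [← Complex.exp_nat_mul]
      rw [← Complex.exp_sum, smul_mul_assoc, ← Complex.exp_add, Algebra.smul_def]
      congr 2
      rw [← mul_add, ← Complex.ofReal_add, hm w]
      push_cast
      rw [Finset.mul_sum]
      refine Finset.sum_congr rfl fun k _ => ?_
      rw [nsmul_eq_mul]
      ring
    rw [map_sum]
    simp_rw [hterm]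
    rw [← Finset.sum_mul, Finset.sum_coe_sort T
      (fun w => g w • Complex.exp (Complex.I * ((w : ℝ) : ℂ))), hg, zero_mul]
  intro w hw
  have := congrArg (MvPolynomial.coeff (m ⟨w, hw⟩)) hP
  simpa [MvPolynomial.coeff_sum, MvPolynomial.coeff_monomial, hminj.eq_iff] using this

/-- The evaluation `X ^ w ↦ exp (i w)` of the group algebra of the sine hull. -/
noncomputable def expEval : AddMonoidAlgebra ℚ sineHull →ₐ[ℚ] ℂ :=
  AddMonoidAlgebra.lift ℚ ℂ sineHull
    { toFun := fun w => Complex.exp (Complex.I * ((w.toAdd : ℝ) : ℂ))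
      map_one' := by simp
      map_mul' := fun a b => by
        rw [← Complex.exp_add, ← mul_add]
        simp }

/-- The augmentation `X ^ w ↦ 1` of the group algebra of the sine hull. -/
noncomputable def augmentation : AddMonoidAlgebra ℚ sineHull →ₐ[ℚ] ℚ :=
  AddMonoidAlgebra.lift ℚ ℚ sineHull 1

theorem expEval_single (w : sineHull) (q : ℚ) :
    expEval (AddMonoidAlgebra.single w q) = q • Complex.exp (Complex.I * ((w : ℝ) : ℂ)) :=
  AddMonoidAlgebra.lift_single _ _ _

theorem augmentation_single (w : sineHull) (q : ℚ) :
    augmentation (AddMonoidAlgebra.single w q) = q := by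
  simp [augmentation]

theorem SchanuelConjecture.expEval_injective (schanuel : SchanuelConjecture) :
    Function.Injective expEval := by
  rw [injective_iff_map_eq_zero]
  intro P hP
  have h := linearIndependent_iff.1 schanuel.linearIndependent_exp_s17 P.coeff <| by
    rw [← hP, expEval, AddMonoidAlgebra.lift_apply, Finsupp.linearCombination_apply]
    rfl
  simpa using h

/-- The element of the group algebra corresponding to `2 i sin a`. -/
noncomputable def sineElement (a : sineHull) : AddMonoidAlgebra ℚ sineHull :=
  AddMonoidAlgebra.single a 1 - AddMonoidAlgebra.single (-a) 1

theorem expEval_sineElement (a : sineHull) :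
    expEval (sineElement a) = 2 * Complex.I * ((Real.sin a : ℝ) : ℂ) := by
  rw [sineElement, map_sub, expEval_single, expEval_single, one_smul, one_smul, Complex.ofReal_sin,
    Complex.sin]
  push_cast
  ring_nf
  simp [Complex.I_sq]
  ring_nf

theorem augmentation_sineElement (a : sineHull) : augmentation (sineElement a) = 0 := by
  simp [sineElement, augmentation_single]

/-- Under Schanuel's conjecture, an element of augmentation zero whose evaluation is `2 i q` with
`q` rational vanishes. -/
theorem SchanuelConjecture.eq_zero_of_expEval_eq (schanuel : SchanuelConjecture)
    {P : AddMonoidAlgebra ℚ sineHull} (haug : augmentation P = 0) {q : ℚ}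
    (hP : expEval P = 2 * Complex.I * (q : ℂ)) : P = 0 := by
  have hsq : P ^ 2 = algebraMap ℚ _ (-4 * q ^ 2) := schanuel.expEval_injective <| by
    rw [map_pow, hP, AlgHom.commutes, eq_ratCast]
    push_cast
    linear_combination 4 * (q : ℂ) ^ 2 * Complex.I_sq
  have h0 := congrArg augmentation hsq
  rw [map_pow, haug, AlgHom.commutes] at h0
  have hq : q = 0 := by simpa using h0
  refine schanuel.expEval_injective ?_
  rw [hP, hq]
  simp

/-- The span of the sine depth sets of level less than `d`. -/
noncomputable def lowerSpan (d : ℕ) : Submodule ℚ ℝ := Submodule.span ℚ (⋃ j : Fin d, sineDepthSet j.1)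

theorem span_sineDepthSet_le_lowerSpan {j d : ℕ} (h : j < d) :
    Submodule.span ℚ (sineDepthSet j) ≤ lowerSpan d :=
  Submodule.span_mono (Set.subset_iUnion (fun j : Fin d => sineDepthSet j.1) ⟨j, h⟩)

theorem lowerSpan_mono {d e : ℕ} (h : d ≤ e) : lowerSpan d ≤ lowerSpan e :=
  Submodule.span_le.2 <| Set.iUnion_subset fun j =>
    Submodule.subset_span.trans (span_sineDepthSet_le_lowerSpan (j.2.trans_le h))

theorem mem_sineDepthSet_succ {d : ℕ} {x : ℝ} :
    x ∈ sineDepthSet (d + 1) ↔ ∃ β γ : ℝ, β ∈ Submodule.span ℚ (sineDepthSet d) ∧ β ≠ 0 ∧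
      γ ∈ lowerSpan d ∧ x = Real.sin (β + γ) := by
  rw [sineDepthSet]
  rfl

theorem sineDepthSet_subset_sineHull (d : ℕ) : sineDepthSet d ⊆ sineHull := by
  induction d using Nat.strong_induction_on with
  | _ d ih =>
    cases d with
    | zero =>
      rw [sineDepthSet]
      rintro _ ⟨q, rfl⟩
      simpa [Rat.smul_def] using sineHull.smul_mem q one_mem_sineHull
    | succ d =>
      intro x hx
      obtain ⟨β, γ, hβ, -, hγ, rfl⟩ := mem_sineDepthSet_succ.1 hx
      refine sin_mem_sineHull (add_mem (Submodule.span_le.2 (ih d d.lt_succ_self) hβ) ?_)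
      exact Submodule.span_le.2 (Set.iUnion_subset fun (j : Fin d) =>
        ih j.1 (j.2.trans d.lt_succ_self)) hγ

theorem lowerSpan_le_sineHull (d : ℕ) : lowerSpan d ≤ sineHull :=
  Submodule.span_le.2 (Set.iUnion_subset fun j => sineDepthSet_subset_sineHull j.1)

/-- The elements `P` of the group algebra of augmentation zero supported on `s`. -/
def augmentationSupported (s : Set sineHull) : Submodule ℚ (AddMonoidAlgebra ℚ sineHull) where
  carrier := {P | augmentation P = 0 ∧ ∀ a ∉ s, P.coeff a = 0}
  zero_mem' := by simp
  add_mem' {P Q} hP hQ := by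
    refine ⟨by simp [hP.1, hQ.1], fun a ha => ?_⟩
    simp [hP.2 a ha, hQ.2 a ha]
  smul_mem' q P hP := by
    refine ⟨by simp [hP.1], fun a ha => ?_⟩
    simp [hP.2 a ha]

theorem sineElement_mem {s : Set sineHull} {a : sineHull} (ha : a ∈ s) (hna : -a ∈ s) :
    sineElement a ∈ augmentationSupported s := by
  refine ⟨augmentation_sineElement a, fun b hb => ?_⟩
  have h1 : a ≠ b := fun h => hb (h ▸ ha)
  have h2 : -a ≠ b := fun h => hb (h ▸ hna)
  simp [sineElement, h1, h2]

/-- If `2 i x`, up to `2 i q` with `q ∈ K`, is the evaluation of an element of augmentation zero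
supported on `s` for every `x ∈ t`, then the same holds for every `x` in the span of `t`. -/
theorem exists_of_mem_span {t : Set ℝ} {s : Set sineHull} (K : Submodule ℚ ℚ)
    (h : ∀ x ∈ t, ∃ q ∈ K, ∃ P ∈ augmentationSupported s,
      expEval P = 2 * Complex.I * ((x - q : ℝ) : ℂ)) {x : ℝ} (hx : x ∈ Submodule.span ℚ t) :
    ∃ q ∈ K, ∃ P ∈ augmentationSupported s, expEval P = 2 * Complex.I * ((x - q : ℝ) : ℂ) := by
  induction hx using Submodule.span_induction with
  | mem x hx => exact h x hx
  | zero => exact ⟨0, zero_mem _, 0, zero_mem _, by simp⟩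
  | add x y _ _ hx hy =>
    obtain ⟨q, hq, P, hP, hPx⟩ := hx
    obtain ⟨r, hr, R, hR, hRy⟩ := hy
    refine ⟨q + r, add_mem hq hr, P + R, add_mem hP hR, ?_⟩
    rw [map_add, hPx, hRy]
    push_cast
    ring
  | smul c x _ hx =>
    obtain ⟨q, hq, P, hP, hPx⟩ := hx
    refine ⟨c * q, K.smul_mem c hq, c • P, Submodule.smul_mem _ _ hP, ?_⟩
    rw [map_smul, hPx, Algebra.smul_def, Rat.smul_def, eq_ratCast]
    push_cast
    ring

theorem SchanuelConjecture.disjoint_span_sineDepthSet (schanuel : SchanuelConjecture) (d : ℕ) :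
    Disjoint (Submodule.span ℚ (sineDepthSet d)) (lowerSpan d) := by
  induction d with
  | zero => simp [lowerSpan]
  | succ d ih =>
    rw [Submodule.disjoint_def]
    intro x hx hx'
    let s : Set sineHull := {a | (a : ℝ) ∈ lowerSpan d}
    obtain ⟨q, hq, P, hP, hPx⟩ := exists_of_mem_span (s := sᶜ) ⊥ (fun x hx => by
      obtain ⟨β, γ, hβ, hβ0, hγ, rfl⟩ := mem_sineDepthSet_succ.1 hx
      have hβγ : β + γ ∉ lowerSpan d := fun hmem => hβ0 <| Submodule.disjoint_def.1 ih β hβ <| by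
        simpa using sub_mem hmem hγ
      have hull : β + γ ∈ sineHull := lowerSpan_le_sineHull (d + 1) <| add_mem
        (span_sineDepthSet_le_lowerSpan d.lt_succ_self hβ) (lowerSpan_mono d.le_succ hγ)
      refine ⟨0, zero_mem _, sineElement ⟨_, hull⟩, sineElement_mem hβγ ?_, ?_⟩
      · exact fun hmem => hβγ (neg_mem_iff.1 hmem)
      · rw [expEval_sineElement]
        simp) hx
    obtain ⟨r, -, R, hR, hRx⟩ := exists_of_mem_span (s := s) ⊤ (fun x hx => by
      obtain ⟨⟨j, hj⟩, hx⟩ := Set.mem_iUnion.1 hx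
      cases j with
      | zero =>
        rw [sineDepthSet] at hx
        obtain ⟨q, rfl⟩ := hx
        exact ⟨q, trivial, 0, zero_mem _, by simp⟩
      | succ j =>
        obtain ⟨β, γ, hβ, -, hγ, rfl⟩ := mem_sineDepthSet_succ.1 hx
        have hjd : j < d := Nat.lt_of_succ_lt_succ hj
        have hβγ : β + γ ∈ lowerSpan d := add_mem
          (span_sineDepthSet_le_lowerSpan hjd hβ) (lowerSpan_mono hjd.le hγ)
        refine ⟨0, trivial, sineElement ⟨_, lowerSpan_le_sineHull d hβγ⟩,
          sineElement_mem hβγ (neg_mem_iff.2 hβγ), ?_⟩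
        rw [expEval_sineElement]
        simp) hx'
    obtain rfl : q = 0 := hq
    have hPR : P - R = 0 := by
      refine schanuel.eq_zero_of_expEval_eq (q := r) (by simp [hP.1, hR.1]) ?_
      rw [map_sub, hPx, hRx]
      push_cast
      ring
    have hP0 : P = 0 := by
      refine AddMonoidAlgebra.coeff_eq_zero.1 (Finsupp.ext fun a => ?_)
      by_cases ha : a ∈ s
      · exact hP.2 a (fun h => h ha)
      · rw [sub_eq_zero.1 hPR]
        exact hR.2 a ha
    rw [hP0] at hPx
    simpa using hPx.symm

/-- **Corollary 4.8.** Assuming Schanuel's conjecture, for every `d > 0` the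
`ℚ`-linear span of `S_d` meets the `ℚ`-linear span of `⋃_{j<d} S_j` only in
`0`. -/
theorem span_sineDepthSet_inter (schanuel : SchanuelConjecture) (d : ℕ) (hd : 0 < d) :
    (↑(Submodule.span ℚ (sineDepthSet d)) ∩
        ↑(Submodule.span ℚ (⋃ j : Fin d, sineDepthSet j.1)) : Set ℝ) = {0} := by
  have h := (schanuel.disjoint_span_sineDepthSet d).eq_bot
  rw [← Submodule.coe_inf]
  exact congrArg SetLike.coe h
end
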